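/- Let Ω ⊆ ℂ be a Denjoy domain with (−∞, 0) ⊂ Ω, and let F ⊆ (−∞, 0] be a closed set. If the quasihyperbolic metric space (Ω, k_Ω) is not Gromov hyperbolic, then the quasihyperbolic metric space (Ω \ F, k_{Ω\F}) is not Gromov hyperbolic either. -/

import Mathlib

open Set Metric Filter Complex

noncomputable section

/-- The length of a curve `γ : [0,1] → E` with respect to the conformal density `ρ`. -/
def curveLen {E : Type*} [NormedAddCommGroup E] [NormedSpace ℝ E]
    (ρ : E → ℝ) (γ : ℝ → E) : ℝ :=
  ∫ t in (0:ℝ)..1, ρ (γ t) * ‖deriv γ t‖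

/-- The distance induced on the set `S` by the conformal density `ρ`, defined as the infimum
of the `ρ`-lengths of C¹ curves joining the two points inside `S`. -/
def densityDist {E : Type*} [NormedAddCommGroup E] [NormedSpace ℝ E]
    (S : Set E) (ρ : E → ℝ) (z w : E) : ℝ :=
  sInf { L | ∃ γ : ℝ → E, ContDiffOn ℝ 1 γ (Icc 0 1) ∧ γ 0 = z ∧ γ 1 = w ∧
      (∀ t ∈ Icc (0:ℝ) 1, γ t ∈ S) ∧ L = curveLen ρ γ }

/-- The quasihyperbolic density `1/δ_Ω(z)` of a domain `Ω`. -/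
def qhDensity {E : Type*} [NormedAddCommGroup E] [NormedSpace ℝ E] (Ω : Set E) : E → ℝ :=
  fun z => (Metric.infDist z Ωᶜ)⁻¹

/-- The quasihyperbolic distance of a domain `Ω`. -/
def qhDist {E : Type*} [NormedAddCommGroup E] [NormedSpace ℝ E] (Ω : Set E) : E → E → ℝ :=
  densityDist Ω (qhDensity Ω)

/-- `lam` is the density of the Poincaré (hyperbolic) metric of the plane domain `Ω`:
it is the pushforward of the density `2/(1-|z|²)` of the unit disk under a holomorphic
universal covering map `p : 𝔻 → Ω`. -/
def IsPoincareDensity (Ω : Set ℂ) (lam : ℂ → ℝ) : Prop :=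
  ∃ p : ℂ → ℂ,
    (∀ z ∈ ball (0:ℂ) 1, DifferentiableAt ℂ p z) ∧
    p '' ball (0:ℂ) 1 = Ω ∧
    IsCoveringMapOn (fun z : ball (0:ℂ) 1 => p z) Ω ∧
    ∀ z ∈ ball (0:ℂ) 1, lam (p z) * ‖deriv p z‖ = 2 / (1 - ‖z‖ ^ 2)

/-- `g` is a geodesic in `(S, d)` from `x` to `y`, parametrized by arclength on
`[0, d x y]`. -/
def IsGeodesicIn {α : Type*} (S : Set α) (d : α → α → ℝ) (g : ℝ → α) (x y : α) : Prop :=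
  g 0 = x ∧ g (d x y) = y ∧ (∀ t ∈ Icc (0:ℝ) (d x y), g t ∈ S) ∧
  ∀ s ∈ Icc (0:ℝ) (d x y), ∀ t ∈ Icc (0:ℝ) (d x y), d (g s) (g t) = |s - t|

/-- Every geodesic triangle of `(S, d)` is `δ`-thin (Rips condition). -/
def GromovHyperbolicWith {α : Type*} (S : Set α) (d : α → α → ℝ) (δ : ℝ) : Prop :=
  ∀ x ∈ S, ∀ y ∈ S, ∀ z ∈ S, ∀ gxy gxz gzy : ℝ → α,
    IsGeodesicIn S d gxy x y → IsGeodesicIn S d gxz x z → IsGeodesicIn S d gzy z y →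
    ∀ t ∈ Icc (0:ℝ) (d x y),
      ∃ p ∈ gxz '' Icc (0:ℝ) (d x z) ∪ gzy '' Icc (0:ℝ) (d z y), d (gxy t) p ≤ δ

/-- `(S, d)` is Gromov hyperbolic: some `δ ≥ 0` works for all geodesic triangles. -/
def IsGromovHyperbolic {α : Type*} (S : Set α) (d : α → α → ℝ) : Prop :=
  ∃ δ : ℝ, 0 ≤ δ ∧ GromovHyperbolicWith S d δ

/-- The real axis inside `ℂ`. -/
def realLine : Set ℂ := {z : ℂ | z.im = 0}

/-- A Denjoy domain: a domain whose boundary is contained in the real axis. -/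
def IsDenjoyDomain (Ω : Set ℂ) : Prop :=
  IsOpen Ω ∧ IsConnected Ω ∧ frontier Ω ⊆ realLine

/-- The distance (for the distance function `d`) from a point to a set. -/
def distToSet {α : Type*} (d : α → α → ℝ) (z : α) (A : Set α) : ℝ :=
  sInf (d z '' A)

/-- A fundamental geodesic: a geodesic of `(S, d)` contained in the closed upper half plane,
joining a point of the boundary interval `I` (on the real axis) to a point of the boundary
interval `J`. -/
def IsFundGeodesic (S : Set ℂ) (d : ℂ → ℂ → ℝ) (I J : Set ℝ) (g : ℝ → ℂ) (x y : ℂ) : Prop :=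
  IsGeodesicIn S d g x y ∧ x.im = 0 ∧ x.re ∈ I ∧ y.im = 0 ∧ y.re ∈ J ∧
  ∀ t ∈ Icc (0:ℝ) (d x y), 0 ≤ (g t).im

end

open Topology Interval ComplexConjugate

noncomputable section

/-- `d` restricted to `S` is a pseudometric. -/
structure IsPseudoDistOn {α : Type*} (S : Set α) (d : α → α → ℝ) : Prop where
  self : ∀ x ∈ S, d x x = 0
  nonneg : ∀ x ∈ S, ∀ y ∈ S, 0 ≤ d x y
  symm : ∀ x ∈ S, ∀ y ∈ S, d x y = d y x
  triangle : ∀ x ∈ S, ∀ y ∈ S, ∀ z ∈ S, d x z ≤ d x y + d y z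

/-- The four-point condition for `d` on `S` with constant `δ`. -/
def FourPointOn {α : Type*} (S : Set α) (d : α → α → ℝ) (δ : ℝ) : Prop :=
  ∀ x ∈ S, ∀ y ∈ S, ∀ z ∈ S, ∀ w ∈ S,
    d x y + d z w ≤ max (d x z + d y w) (d x w + d y z) + δ

theorem FourPointOn.mono {α : Type*} {S : Set α} {d : α → α → ℝ} {δ δ' : ℝ}
    (h : FourPointOn S d δ) (hδ : δ ≤ δ') : FourPointOn S d δ' :=
  fun x hx y hy z hz w hw => (h x hx y hy z hz w hw).trans (add_le_add le_rfl hδ)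

section Abstract

variable {α : Type*} {S U : Set α} {d : α → α → ℝ}

theorem IsPseudoDistOn.mono {T : Set α} (h : IsPseudoDistOn S d) (hT : T ⊆ S) :
    IsPseudoDistOn T d :=
  ⟨fun x hx => h.self x (hT hx), fun x hx y hy => h.nonneg x (hT hx) y (hT hy),
    fun x hx y hy => h.symm x (hT hx) y (hT hy),
    fun x hx y hy z hz => h.triangle x (hT hx) y (hT hy) z (hT hz)⟩

/-- A point on a geodesic splits its length. -/
theorem IsGeodesicIn.dist_left {g : ℝ → α} {x y : α} (hg : IsGeodesicIn U d g x y) {t : ℝ}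
    (ht : t ∈ Icc (0:ℝ) (d x y)) : d x (g t) = t := by
  have h := hg.2.2.2 0 ⟨le_rfl, ht.1.trans ht.2⟩ t ht
  rwa [hg.1, zero_sub, abs_neg, abs_of_nonneg ht.1] at h

theorem IsGeodesicIn.dist_right {g : ℝ → α} {x y : α} (hg : IsGeodesicIn U d g x y) {t : ℝ}
    (ht : t ∈ Icc (0:ℝ) (d x y)) : d (g t) y = d x y - t := by
  have h := hg.2.2.2 t ht (d x y) ⟨ht.1.trans ht.2, le_rfl⟩
  rw [hg.2.1, abs_sub_comm, abs_of_nonneg (by linarith [ht.2])] at h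
  exact h

/-- In a space with thin triangles, the distance from `w` to a geodesic `[x, y]` is at most the
Gromov product `(x|y)_w` up to an additive constant. -/
theorem exists_near_geodesic_of_thin {δ : ℝ} (hH : GromovHyperbolicWith U d δ) (hSU : S ⊆ U)
    (hd : IsPseudoDistOn S d)
    (hgeo : ∀ x ∈ S, ∀ y ∈ S, ∃ g, IsGeodesicIn U d g x y ∧ ∀ t ∈ Icc (0:ℝ) (d x y), g t ∈ S)
    {x y w : α} (hx : x ∈ S) (hy : y ∈ S) (hw : w ∈ S) {g : ℝ → α} (hg : IsGeodesicIn U d g x y)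
    (hgS : ∀ t ∈ Icc (0:ℝ) (d x y), g t ∈ S) (hδ : 0 ≤ δ) :
    ∃ t ∈ Icc (0:ℝ) (d x y), 2 * d w (g t) ≤ d w x + d w y - d x y + 4 * δ + 2 := by
  obtain ⟨g₁, hg₁, hg₁S⟩ := hgeo x hx w hw
  obtain ⟨g₂, hg₂, hg₂S⟩ := hgeo w hw y hy
  have hthin := hH x (hSU hx) y (hSU hy) w (hSU hw) g g₁ g₂ hg hg₁ hg₂
  have hL := hd.nonneg x hx y hy
  have hL1 := hd.nonneg x hx w hw
  have hL2 := hd.nonneg w hw y hy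
  set T : Set ℝ := {t | t ∈ Icc (0:ℝ) (d x y) ∧ ∃ s ∈ Icc (0:ℝ) (d x w), d (g t) (g₁ s) ≤ δ}
  have hT0 : (0:ℝ) ∈ T := by
    refine ⟨⟨le_rfl, hL⟩, 0, ⟨le_rfl, hL1⟩, ?_⟩
    rw [hg.1, hg₁.1, hd.self x hx]; exact hδ
  have hTb : BddAbove T := ⟨d x y, fun t ht => ht.1.2⟩
  obtain ⟨t₁, ht₁T, ht₁⟩ := exists_lt_of_lt_csSup ⟨0, hT0⟩ (sub_one_lt (sSup T))
  obtain ⟨ht₁I, s, hs, hs'⟩ := ht₁T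
  -- a nearby point close to the other side
  have key : ∃ t₂ ∈ Icc (0:ℝ) (d x y), t₁ ≤ t₂ ∧ t₂ ≤ t₁ + 1 ∧
      ∃ r ∈ Icc (0:ℝ) (d w y), d (g t₂) (g₂ r) ≤ δ := by
    rcases le_or_gt (t₁ + 1) (d x y) with h | h
    · have hI : t₁ + 1 ∈ Icc (0:ℝ) (d x y) := ⟨by linarith [ht₁I.1], h⟩
      refine ⟨t₁ + 1, hI, by linarith, le_rfl, ?_⟩
      obtain ⟨p, hp | hp, hpd⟩ := hthin _ hI
      · obtain ⟨s', hs', rfl⟩ := hp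
        have : t₁ + 1 ≤ sSup T := le_csSup hTb ⟨hI, s', hs', hpd⟩
        linarith
      · obtain ⟨r, hr, rfl⟩ := hp
        exact ⟨r, hr, hpd⟩
    · refine ⟨d x y, ⟨hL, le_rfl⟩, ht₁I.2, h.le, d w y, ⟨hL2, le_rfl⟩, ?_⟩
      rw [hg.2.1, hg₂.2.1, hd.self y hy]; exact hδ
  obtain ⟨t₂, ht₂I, h12, h21, r, hr, hr'⟩ := key
  refine ⟨t₁, ht₁I, ?_⟩
  have a1 := hg₁.dist_left hs
  have a2 := hg₁.dist_right hs
  have a3 := hg₂.dist_left hr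
  have a4 := hg₂.dist_right hr
  have a5 := hg.dist_left ht₁I
  have a6 := hg.dist_right ht₁I
  have a7 := hg.2.2.2 t₁ ht₁I t₂ ht₂I
  rw [abs_sub_comm, abs_of_nonneg (by linarith)] at a7
  have m1 := hgS _ ht₁I
  have m2 := hgS _ ht₂I
  have m3 := hg₁S _ hs
  have m4 := hg₂S _ hr
  have b1 := hd.triangle _ m1 _ m3 _ hw
  have b2 := hd.triangle _ hx _ m3 _ m1
  have b3 := hd.triangle _ hw _ m4 _ m1
  have b4 := hd.triangle _ m1 _ m4 _ hy
  have b5 := hd.triangle _ m1 _ m2 _ m4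
  rw [hd.symm _ m3 _ m1] at b2
  rw [hd.symm _ m4 _ m1] at b3
  rw [hd.symm _ m1 _ hw] at b1
  have := hd.symm _ hx _ hw
  linarith

/-- Thin triangles imply the four-point condition. -/
theorem fourPointOn_of_thin {δ : ℝ} (hH : GromovHyperbolicWith U d δ) (hSU : S ⊆ U)
    (hd : IsPseudoDistOn S d)
    (hgeo : ∀ x ∈ S, ∀ y ∈ S, ∃ g, IsGeodesicIn U d g x y ∧ ∀ t ∈ Icc (0:ℝ) (d x y), g t ∈ S)
    (hδ : 0 ≤ δ) : FourPointOn S d (6 * δ + 2) := by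
  intro x hx z hz y hy w hw
  obtain ⟨g, hg, hgS⟩ := hgeo x hx z hz
  obtain ⟨t, ht, hwt⟩ := exists_near_geodesic_of_thin hH hSU hd hgeo hx hz hw hg hgS hδ
  obtain ⟨g₁, hg₁, hg₁S⟩ := hgeo x hx y hy
  obtain ⟨g₂, hg₂, hg₂S⟩ := hgeo y hy z hz
  have m1 := hgS _ ht
  have e1 := hd.symm _ hw _ hx
  have e2 := hd.symm _ hw _ hz
  have e3 := hd.symm _ hw _ hy
  have e4 := hd.symm _ hz _ hy
  obtain ⟨p, hp | hp, hpd⟩ := hH x (hSU hx) z (hSU hz) y (hSU hy) g g₁ g₂ hg hg₁ hg₂ t ht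
  · obtain ⟨s, hs, rfl⟩ := hp
    have m2 := hg₁S _ hs
    have b1 := hd.triangle _ hw _ m1 _ m2
    have b2 := hd.triangle _ hx _ m2 _ hw
    have b3 := hd.triangle _ hw _ m2 _ hy
    have b4 := hg₁.dist_left hs
    have b5 := hg₁.dist_right hs
    have b6 := hd.symm _ hw _ m2
    have : d x z + d y w ≤ d x y + d z w + (6 * δ + 2) := by linarith
    exact this.trans (by gcongr; exact le_max_left _ _)
  · obtain ⟨s, hs, rfl⟩ := hp
    have m2 := hg₂S _ hs
    have b1 := hd.triangle _ hw _ m1 _ m2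
    have b2 := hd.triangle _ hy _ m2 _ hw
    have b3 := hd.triangle _ hw _ m2 _ hz
    have b4 := hg₂.dist_left hs
    have b5 := hg₂.dist_right hs
    have b6 := hd.symm _ hw _ m2
    have : d x z + d y w ≤ d x w + d z y + (6 * δ + 2) := by linarith
    exact this.trans (by gcongr; exact le_max_right _ _)

/-- Distance from a point to a geodesic, in terms of Gromov products. -/
theorem exists_geodesic_point_le {δ : ℝ} (h4 : FourPointOn S d δ)
    (hd : IsPseudoDistOn S d) {x y w : α} (hx : x ∈ S) (hy : y ∈ S) (hw : w ∈ S) {p : ℝ → α}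
    (hp : ∀ t ∈ Icc (0:ℝ) (d x y), p t ∈ S ∧ d x (p t) = t ∧ d (p t) y = d x y - t) :
    ∃ t ∈ Icc (0:ℝ) (d x y), 2 * d w (p t) ≤ d w x + d w y - d x y + 2 * δ := by
  have e1 := hd.symm _ hw _ hx
  have e2 := hd.symm _ hw _ hy
  have b1 := hd.triangle _ hx _ hy _ hw
  have b2 := hd.triangle _ hx _ hw _ hy
  have b3 := hd.triangle _ hw _ hx _ hy
  have e3 := hd.symm _ hy _ hw
  have hI : (d x y + d w x - d w y) / 2 ∈ Icc (0:ℝ) (d x y) := ⟨by linarith, by linarith⟩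
  refine ⟨_, hI, ?_⟩
  obtain ⟨hm, h1, h2⟩ := hp _ hI
  set q := p ((d x y + d w x - d w y) / 2)
  have e4 := hd.symm _ hm _ hy
  have e5 := hd.symm _ hm _ hw
  have := h4 x hx y hy q hm w hw
  rcases le_total (d x q + d y w) (d x w + d y q) with h | h
  · rw [max_eq_right h] at this; linarith
  · rw [max_eq_left h] at this; linarith

/-- The four-point condition implies thin triangles. -/
theorem isGromovHyperbolicWith_of_fourPointOn {δ : ℝ} (h4 : FourPointOn S d δ)
    (hd : IsPseudoDistOn S d) : GromovHyperbolicWith S d (3 / 2 * δ) := by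
  intro x hx y hy z hz gxy gxz gzy hxy hxz hzy t ht
  have hm := hxy.2.2.1 t ht
  have c1 := hxy.dist_left ht
  have c2 := hxy.dist_right ht
  have e1 := hd.symm _ hm _ hx
  have e2 := hd.symm _ hm _ hy
  have e3 := hd.symm _ hm _ hz
  have e4 := hd.symm _ hy _ hz
  have := h4 x hx y hy z hz (gxy t) hm
  rcases le_total (d x z + d y (gxy t)) (d x (gxy t) + d y z) with h | h
  · rw [max_eq_right h] at this
    obtain ⟨s, hs, h'⟩ := exists_geodesic_point_le h4 hd hz hy hm (p := gzy)
      (fun s hs => ⟨hzy.2.2.1 s hs, hzy.dist_left hs, hzy.dist_right hs⟩)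
    exact ⟨gzy s, Or.inr ⟨s, hs, rfl⟩, by linarith⟩
  · rw [max_eq_left h] at this
    obtain ⟨s, hs, h'⟩ := exists_geodesic_point_le h4 hd hx hz hm (p := gxz)
      (fun s hs => ⟨hxz.2.2.1 s hs, hxz.dist_left hs, hxz.dist_right hs⟩)
    exact ⟨gxz s, Or.inl ⟨s, hs, rfl⟩, by linarith⟩

/-- If a subset `A` of a space satisfying the four-point condition is quasiconvex, then the distance
between the almost nearest point projections of two points to `A` is either bounded or
essentially contributes to the distance of the two points. -/
theorem proj_dichotomy {X A : Set α} {C : ℝ} {π : α → α} (hAX : A ⊆ X)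
    (hd : IsPseudoDistOn X d) (h4 : FourPointOn X d C)
    (hQC : ∀ a ∈ A, ∀ b ∈ A, ∀ w ∈ X, ∃ p ∈ A, 2 * d w p ≤ d w a + d w b - d a b + C)
    (hπA : ∀ w ∈ X, π w ∈ A) (hπ : ∀ w ∈ X, ∀ p ∈ A, d w (π w) ≤ d w p + 1)
    {x y : α} (hx : x ∈ X) (hy : y ∈ X) :
    d (π x) (π y) ≤ 3 * C + 4 ∨
      d x (π x) + d y (π y) + d (π x) (π y) ≤ d x y + (3 * C + 4) := by
  have ha := hπA x hx
  have hb := hπA y hy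
  obtain ⟨p, hp, hp'⟩ := hQC _ ha _ hb x hx
  obtain ⟨q, hq, hq'⟩ := hQC _ hb _ ha y hy
  have h1 := hπ x hx p hp
  have h2 := hπ y hy q hq
  have e := hd.symm _ (hAX ha) _ (hAX hb)
  have e2 := hd.symm _ hy _ (hAX ha)
  have e3 := hd.symm _ hy _ (hAX hb)
  have := h4 x hx _ (hAX hb) y hy _ (hAX ha)
  rcases le_total (d x y + d (π y) (π x)) (d x (π x) + d (π y) y) with h | h
  · rw [max_eq_right h] at this
    have := hd.nonneg _ (hAX ha) _ (hAX hb)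
    left; linarith
  · rw [max_eq_left h] at this
    right; linarith

/-- Suppose that, up to additive errors, `S` is the double of `X` along the quasiconvex subset `A`,
where `X` satisfies the four-point condition. Then `S` satisfies the four-point condition. -/
theorem exists_fourPointOn_of_double {X A : Set α} {C : ℝ} (hC : 0 ≤ C) (hXS : X ⊆ S) (hAX : A ⊆ X)
    (hA : A.Nonempty) (hd : IsPseudoDistOn S d) (h4 : FourPointOn X d C)
    (hQC : ∀ a ∈ A, ∀ b ∈ A, ∀ w ∈ X, ∃ p ∈ A, 2 * d w p ≤ d w a + d w b - d a b + C)
    (Ψ : α → α) (hΨ : ∀ z ∈ S, Ψ z ∈ X) (s : α → Prop)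
    (hsame : ∀ z ∈ S, ∀ w ∈ S, (s z ↔ s w) → |d z w - d (Ψ z) (Ψ w)| ≤ C)
    (hopp : ∀ z ∈ S, ∀ w ∈ S, ¬ (s z ↔ s w) →
      (∀ p ∈ A, d z w ≤ d (Ψ z) p + d p (Ψ w) + C) ∧
      ∃ p ∈ A, d (Ψ z) p + d p (Ψ w) ≤ d z w + C) :
    ∃ δ, FourPointOn S d δ := by
  have hdX := hd.mono hXS
  have hproj : ∀ w ∈ X, ∃ a ∈ A, ∀ p ∈ A, d w a ≤ d w p + 1 := by
    intro w hw
    obtain ⟨a₀, ha₀⟩ := hA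
    have hb : BddBelow (d w '' A) := ⟨0, by
      rintro _ ⟨p, hp, rfl⟩; exact hdX.nonneg w hw p (hAX hp)⟩
    obtain ⟨_, ⟨a, ha, rfl⟩, h⟩ :=
      exists_lt_of_csInf_lt ⟨_, mem_image_of_mem (d w) ha₀⟩ (lt_add_one (sInf (d w '' A)))
    refine ⟨a, ha, fun p hp => ?_⟩
    have := csInf_le hb (mem_image_of_mem (d w) hp)
    linarith
  classical
  obtain ⟨π, hπ'⟩ : ∃ π : α → α, ∀ w ∈ X, π w ∈ A ∧ ∀ p ∈ A, d w (π w) ≤ d w p + 1 := by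
    choose! π h1 h2 using hproj
    exact ⟨π, fun w hw => ⟨h1 w hw, h2 w hw⟩⟩
  have hπA := fun w hw => (hπ' w hw).1
  have hπ := fun w hw => (hπ' w hw).2
  have hdich := fun x (hx : x ∈ X) y (hy : y ∈ X) =>
    proj_dichotomy hAX hdX h4 hQC hπA hπ hx hy
  have happ : ∀ z ∈ S, ∀ w ∈ S, ¬ (s z ↔ s w) →
      |d z w - (d (Ψ z) (π (Ψ w)) + d (Ψ w) (π (Ψ w)))| ≤ 4 * C + 6 := by
    intro z hz w hw hzw
    have hx := hΨ z hz
    have hy := hΨ w hw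
    obtain ⟨h1, p, hp, h2⟩ := hopp z hz w hw hzw
    have h3 := h1 _ (hπA _ hy)
    have e := hdX.symm _ (hAX (hπA _ hy)) _ hy
    have e2 := hdX.symm _ (hAX hp) _ hy
    have h4 := hπ _ hx p hp
    have h5 := hπ _ hy p hp
    have h6 := hdX.triangle _ hx _ (hAX hp) _ hy
    have h7 := hdX.triangle _ hx _ (hAX (hπA _ hx)) _ (hAX (hπA _ hy))
    rw [abs_le]
    rcases hdich _ hx _ hy with h | h <;> constructor <;> linarith
  have hthree : ∀ x ∈ S, ∀ y ∈ S, ∀ z ∈ S, ∀ w ∈ S, (s x ↔ s y) → (s x ↔ s z) → ¬ (s x ↔ s w) →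
      d x y + d z w ≤ max (d x z + d y w) (d x w + d y z) + (24 * C + 48) := by
    intro x hx y hy z hz w hw hxy hxz hxw
    have hp := hAX (hπA _ (hΨ w hw))
    have h := h4 _ (hΨ x hx) _ (hΨ y hy) _ (hΨ z hz) _ hp
    have a1 := abs_le.1 (hsame x hx y hy hxy)
    have a2 := abs_le.1 (hsame x hx z hz hxz)
    have a3 := abs_le.1 (hsame y hy z hz (by tauto))
    have b1 := abs_le.1 (happ x hx w hw hxw)
    have b2 := abs_le.1 (happ y hy w hw (by tauto))
    have b3 := abs_le.1 (happ z hz w hw (by tauto))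
    rcases le_total (d (Ψ x) (Ψ z) + d (Ψ y) (π (Ψ w))) (d (Ψ x) (π (Ψ w)) + d (Ψ y) (Ψ z))
      with h' | h'
    · rw [max_eq_right h'] at h
      have := le_max_right (d x z + d y w) (d x w + d y z)
      linarith
    · rw [max_eq_left h'] at h
      have := le_max_left (d x z + d y w) (d x w + d y z)
      linarith
  have hfour : ∀ x ∈ S, ∀ y ∈ S, ∀ z ∈ S, ∀ w ∈ S, (s x ↔ s y) → (s x ↔ s z) → (s x ↔ s w) →
      d x y + d z w ≤ max (d x z + d y w) (d x w + d y z) + (24 * C + 48) := by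
    intro x hx y hy z hz w hw hxy hxz hxw
    have h := h4 _ (hΨ x hx) _ (hΨ y hy) _ (hΨ z hz) _ (hΨ w hw)
    have a1 := abs_le.1 (hsame x hx y hy hxy)
    have a2 := abs_le.1 (hsame x hx z hz hxz)
    have a3 := abs_le.1 (hsame y hy z hz (by tauto))
    have b1 := abs_le.1 (hsame x hx w hw hxw)
    have b2 := abs_le.1 (hsame y hy w hw (by tauto))
    have b3 := abs_le.1 (hsame z hz w hw (by tauto))
    rcases le_total (d (Ψ x) (Ψ z) + d (Ψ y) (Ψ w)) (d (Ψ x) (Ψ w) + d (Ψ y) (Ψ z))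
      with h' | h'
    · rw [max_eq_right h'] at h
      have := le_max_right (d x z + d y w) (d x w + d y z)
      linarith
    · rw [max_eq_left h'] at h
      have := le_max_left (d x z + d y w) (d x w + d y z)
      linarith
  have hpair : ∀ x ∈ S, ∀ y ∈ S, ∀ z ∈ S, ∀ w ∈ S, (s x ↔ s y) → (s z ↔ s w) → ¬ (s x ↔ s z) →
      d x y + d z w ≤ max (d x z + d y w) (d x w + d y z) + (24 * C + 48) := by
    intro x hx y hy z hz w hw hxy hzw hxz
    have hz' := hΨ z hz
    have hw' := hΨ w hw
    have hp := hAX (hπA _ hz')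
    have hq := hAX (hπA _ hw')
    have h := h4 _ (hΨ x hx) _ (hΨ y hy) _ hp _ hq
    have a1 := abs_le.1 (hsame x hx y hy hxy)
    have a2 := abs_le.1 (hsame z hz w hw hzw)
    have b1 := abs_le.1 (happ x hx z hz hxz)
    have b2 := abs_le.1 (happ y hy z hz (by tauto))
    have b3 := abs_le.1 (happ x hx w hw (by tauto))
    have b4 := abs_le.1 (happ y hy w hw (by tauto))
    have t1 := hdX.triangle _ hz' _ hp _ hw'
    have t2 := hdX.triangle _ hp _ hq _ hw'
    have e := hdX.symm _ hq _ hw'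
    rcases le_total (d (Ψ x) (π (Ψ z)) + d (Ψ y) (π (Ψ w)))
      (d (Ψ x) (π (Ψ w)) + d (Ψ y) (π (Ψ z))) with h' | h'
    · rw [max_eq_right h'] at h
      have := le_max_right (d x z + d y w) (d x w + d y z)
      linarith
    · rw [max_eq_left h'] at h
      have := le_max_left (d x z + d y w) (d x w + d y z)
      linarith
  have hcross : ∀ x ∈ S, ∀ y ∈ S, ∀ z ∈ S, ∀ w ∈ S, (s x ↔ s z) → (s y ↔ s w) → ¬ (s x ↔ s y) →
      d x y + d z w ≤ max (d x z + d y w) (d x w + d y z) + (24 * C + 48) := by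
    intro x hx y hy z hz w hw hxz hyw hxy
    have hy' := hΨ y hy
    have hw' := hΨ w hw
    have hp := hAX (hπA _ hy')
    have hq := hAX (hπA _ hw')
    have h := h4 _ (hΨ x hx) _ hp _ (hΨ z hz) _ hq
    have a1 := abs_le.1 (hsame x hx z hz hxz)
    have a2 := abs_le.1 (hsame y hy w hw hyw)
    have b1 := abs_le.1 (happ x hx y hy hxy)
    have b2 := abs_le.1 (happ z hz y hy (by tauto))
    have b3 := abs_le.1 (happ x hx w hw (by tauto))
    have b4 := abs_le.1 (happ z hz w hw (by tauto))
    have e1 := hd.symm _ hy _ hz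
    have e2 := hdX.symm _ hp _ (hΨ z hz)
    have e3 := hdX.symm _ hp _ hq
    rcases hdich _ hy' _ hw' with hc | hc
    · have t1 := hdX.triangle _ (hΨ x hx) _ hq _ hp
      have t2 := hdX.triangle _ (hΨ z hz) _ hp _ hq
      have := le_max_right (d x z + d y w) (d x w + d y z)
      linarith
    · rcases le_total (d (Ψ x) (Ψ z) + d (π (Ψ y)) (π (Ψ w)))
        (d (Ψ x) (π (Ψ w)) + d (π (Ψ y)) (Ψ z)) with h' | h'
      · rw [max_eq_right h'] at h
        have := le_max_right (d x z + d y w) (d x w + d y z)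
        linarith
      · rw [max_eq_left h'] at h
        have := le_max_left (d x z + d y w) (d x w + d y z)
        linarith
  refine ⟨24 * C + 48, fun x hx y hy z hz w hw => ?_⟩
  have exy := hd.symm _ hx _ hy
  have exz := hd.symm _ hx _ hz
  have exw := hd.symm _ hx _ hw
  have eyz := hd.symm _ hy _ hz
  have eyw := hd.symm _ hy _ hw
  have ezw := hd.symm _ hz _ hw
  by_cases hxy : s x ↔ s y
  · by_cases hxz : s x ↔ s z
    · by_cases hxw : s x ↔ s w
      · exact hfour x hx y hy z hz w hw hxy hxz hxw
      · exact hthree x hx y hy z hz w hw hxy hxz hxw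
    · by_cases hxw : s x ↔ s w
      · have := hthree x hx y hy w hw z hz hxy hxw hxz
        rwa [max_comm, ← ezw] at this
      · exact hpair x hx y hy z hz w hw hxy (by tauto) hxz
  · by_cases hxz : s x ↔ s z
    · by_cases hxw : s x ↔ s w
      · have := hthree z hz w hw x hx y hy (by tauto) (by tauto) (by tauto)
        rw [← exz, ← eyz, ← eyw, ← exw, add_comm (d z w)] at this
        rwa [add_comm (d x w)]
      · exact hcross x hx y hy z hz w hw hxz (by tauto) hxy
    · by_cases hxw : s x ↔ s w
      · have := hcross x hx y hy w hw z hz hxw (by tauto) hxy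
        rwa [max_comm, ← ezw] at this
      · have := hthree z hz w hw y hy x hx (by tauto) (by tauto) (by tauto)
        rw [← exz, ← eyz, ← eyw, ← exw, ← exy, add_comm (d z w), max_comm, add_comm (d y z)] at this
        exact this

end Abstract

section QuasiHyperbolic

variable {U V : Set ℂ} {γ : ℝ → ℂ} {x y z : ℂ}

theorem infDist_compl_pos (hU : IsOpen U) (hne : Uᶜ.Nonempty) (hz : z ∈ U) :
    0 < infDist z Uᶜ :=
  (hU.isClosed_compl.notMem_iff_infDist_pos hne).1 (by simpa using hz)

theorem mem_of_infDist_compl_pos (hz : 0 < infDist z Uᶜ) : z ∈ U := by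
  by_contra h
  exact hz.ne' (infDist_zero_of_mem h)

theorem qhDensity_nonneg (U : Set ℂ) (z : ℂ) : 0 ≤ qhDensity U z := inv_nonneg.2 infDist_nonneg

theorem continuousOn_qhDensity (hU : IsOpen U) (hne : Uᶜ.Nonempty) :
    ContinuousOn (qhDensity U) U :=
  (continuous_infDist_pt _).continuousOn.inv₀ fun _ hz => (infDist_compl_pos hU hne hz).ne'

/-- The `C¹` curves in `U` from `x` to `y` parametrized by `[0, 1]`. -/
def curvesIn (U : Set ℂ) (x y : ℂ) : Set (ℝ → ℂ) :=
  {γ | ContDiffOn ℝ 1 γ (Icc 0 1) ∧ γ 0 = x ∧ γ 1 = y ∧ ∀ t ∈ Icc (0:ℝ) 1, γ t ∈ U}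

/-- The points `x` and `y` are joined by a `C¹` curve in `U`. -/
def CurveJoined (U : Set ℂ) (x y : ℂ) : Prop := (curvesIn U x y).Nonempty

/-- The quasihyperbolic speed of a curve on `[0, 1]`. -/
def qhSpeed (U : Set ℂ) (γ : ℝ → ℂ) (t : ℝ) : ℝ :=
  qhDensity U (γ t) * ‖derivWithin γ (Icc 0 1) t‖

theorem qhSpeed_nonneg (U : Set ℂ) (γ : ℝ → ℂ) (t : ℝ) : 0 ≤ qhSpeed U γ t :=
  mul_nonneg (qhDensity_nonneg U _) (norm_nonneg _)

theorem continuousOn_qhSpeed (hU : IsOpen U) (hne : Uᶜ.Nonempty) (hγ : γ ∈ curvesIn U x y) :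
    ContinuousOn (qhSpeed U γ) (Icc 0 1) :=
  ((continuousOn_qhDensity hU hne).comp hγ.1.continuousOn hγ.2.2.2).mul
    (hγ.1.continuousOn_derivWithin (uniqueDiffOn_Icc one_pos) le_rfl).norm

theorem intervalIntegrable_qhSpeed (hU : IsOpen U) (hne : Uᶜ.Nonempty) (hγ : γ ∈ curvesIn U x y)
    {a b : ℝ} (ha : a ∈ Icc (0:ℝ) 1) (hb : b ∈ Icc (0:ℝ) 1) :
    IntervalIntegrable (qhSpeed U γ) MeasureTheory.volume a b :=
  ((continuousOn_qhSpeed hU hne hγ).mono (uIcc_subset_Icc ha hb)).intervalIntegrable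

theorem curveLen_eq_integral_qhSpeed (U : Set ℂ) (γ : ℝ → ℂ) :
    curveLen (qhDensity U) γ = ∫ t in (0:ℝ)..1, qhSpeed U γ t := by
  refine intervalIntegral.integral_congr_Ioo_of_le zero_le_one fun t ht => ?_
  simp only [qhSpeed]
  rw [derivWithin_of_mem_nhds (Icc_mem_nhds ht.1 ht.2)]

theorem curveLen_nonneg (U : Set ℂ) (γ : ℝ → ℂ) : 0 ≤ curveLen (qhDensity U) γ := by
  rw [curveLen_eq_integral_qhSpeed]
  exact intervalIntegral.integral_nonneg zero_le_one fun t _ => qhSpeed_nonneg U γ t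

theorem qhDist_eq_sInf (U : Set ℂ) (x y : ℂ) :
    qhDist U x y = sInf (curveLen (qhDensity U) '' curvesIn U x y) := by
  unfold qhDist densityDist curvesIn
  congr 1
  ext L
  constructor
  · rintro ⟨γ, h1, h2, h3, h4, rfl⟩
    exact ⟨γ, ⟨h1, h2, h3, h4⟩, rfl⟩
  · rintro ⟨γ, ⟨h1, h2, h3, h4⟩, rfl⟩
    exact ⟨γ, h1, h2, h3, h4, rfl⟩

theorem qhDist_nonneg (U : Set ℂ) (x y : ℂ) : 0 ≤ qhDist U x y := by
  rw [qhDist_eq_sInf]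
  refine Real.sInf_nonneg ?_
  rintro _ ⟨γ, -, rfl⟩
  exact curveLen_nonneg U γ

theorem qhDist_le_curveLen (hγ : γ ∈ curvesIn U x y) :
    qhDist U x y ≤ curveLen (qhDensity U) γ := by
  rw [qhDist_eq_sInf]
  refine csInf_le ⟨0, ?_⟩ (mem_image_of_mem _ hγ)
  rintro _ ⟨γ, -, rfl⟩
  exact curveLen_nonneg U γ

theorem CurveJoined.exists_curveLen_lt (h : CurveJoined U x y) {ε : ℝ} (hε : 0 < ε) :
    ∃ γ ∈ curvesIn U x y, curveLen (qhDensity U) γ < qhDist U x y + ε := by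
  rw [qhDist_eq_sInf]
  obtain ⟨_, ⟨γ, hγ, rfl⟩, h'⟩ := exists_lt_of_csInf_lt (h.image _)
    (lt_add_of_pos_right (sInf (curveLen (qhDensity U) '' curvesIn U x y)) hε)
  exact ⟨γ, hγ, h'⟩

theorem const_mem_curvesIn (hx : x ∈ U) : (fun _ => x) ∈ curvesIn U x x :=
  ⟨contDiffOn_const, rfl, rfl, fun _ _ => hx⟩

theorem qhDist_self (hx : x ∈ U) : qhDist U x x = 0 := by
  refine le_antisymm ((qhDist_le_curveLen (const_mem_curvesIn hx)).trans_eq ?_) (qhDist_nonneg _ _ _)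
  simp [curveLen]

theorem CurveJoined.left_mem (h : CurveJoined U x y) : x ∈ U := by
  obtain ⟨γ, -, rfl, -, h⟩ := h
  exact h 0 (by simp)

theorem CurveJoined.right_mem (h : CurveJoined U x y) : y ∈ U := by
  obtain ⟨γ, -, -, rfl, h⟩ := h
  exact h 1 (by simp)

theorem reverse_mem_curvesIn (hγ : γ ∈ curvesIn U x y) : (fun t => γ (1 - t)) ∈ curvesIn U y x := by
  obtain ⟨h1, h2, h3, h4⟩ := hγ
  have hm : ∀ t ∈ Icc (0:ℝ) 1, 1 - t ∈ Icc (0:ℝ) 1 := fun t ht =>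
    ⟨by linarith [ht.2], by linarith [ht.1]⟩
  exact ⟨h1.comp (contDiff_const.sub contDiff_id).contDiffOn hm, by simp [h3], by simp [h2],
    fun t ht => h4 _ (hm t ht)⟩

theorem CurveJoined.symm (h : CurveJoined U x y) : CurveJoined U y x := by
  obtain ⟨γ, hγ⟩ := h
  exact ⟨_, reverse_mem_curvesIn hγ⟩

theorem qhDist_comm (U : Set ℂ) (x y : ℂ) : qhDist U x y = qhDist U y x := by
  have key : ∀ x y, ∀ L ∈ curveLen (qhDensity U) '' curvesIn U x y,
      L ∈ curveLen (qhDensity U) '' curvesIn U y x := by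
    rintro x y _ ⟨γ, hγ, rfl⟩
    refine ⟨_, reverse_mem_curvesIn hγ, ?_⟩
    unfold curveLen
    simp only [deriv_comp_const_sub, norm_neg]
    rw [intervalIntegral.integral_comp_sub_left (fun t => qhDensity U (γ t) * ‖deriv γ t‖) 1]
    simp
  rw [qhDist_eq_sInf, qhDist_eq_sInf]
  congr 1
  exact Subset.antisymm (key x y) (key y x)

/-- The concatenation of two `C¹` curves, reparametrized so that it is again `C¹`. -/
theorem exists_concat_curve (hU : IsOpen U) (hne : Uᶜ.Nonempty) {γ₁ γ₂ : ℝ → ℂ}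
    (h₁ : γ₁ ∈ curvesIn U x y) (h₂ : γ₂ ∈ curvesIn U y z) :
    ∃ γ ∈ curvesIn U x z, curveLen (qhDensity U) γ =
      curveLen (qhDensity U) γ₁ + curveLen (qhDensity U) γ₂ := by
  let φ₁ : ℝ → ℝ := fun t => Real.smoothTransition (2 * t)
  let φ₂ : ℝ → ℝ := fun t => Real.smoothTransition (2 * t - 1)
  have hφ₁ : ContDiff ℝ 1 φ₁ := Real.smoothTransition.contDiff.comp (contDiff_const.mul contDiff_id)
  have hφ₂ : ContDiff ℝ 1 φ₂ :=
    Real.smoothTransition.contDiff.comp ((contDiff_const.mul contDiff_id).sub contDiff_const)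
  have hI₁ : ∀ t, φ₁ t ∈ Icc (0:ℝ) 1 := fun t =>
    ⟨Real.smoothTransition.nonneg _, Real.smoothTransition.le_one _⟩
  have hI₂ : ∀ t, φ₂ t ∈ Icc (0:ℝ) 1 := fun t =>
    ⟨Real.smoothTransition.nonneg _, Real.smoothTransition.le_one _⟩
  have hm₁ : Monotone φ₁ := fun s t hst => Real.smoothTransition.monotone (by linarith)
  have hm₂ : Monotone φ₂ := fun s t hst => Real.smoothTransition.monotone (by linarith)
  have hc₁ : ∀ t, 1 / 2 ≤ t → φ₁ t = 1 := fun t ht =>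
    Real.smoothTransition.one_of_one_le (by linarith)
  have hc₂ : ∀ t, t ≤ 1 / 2 → φ₂ t = 0 := fun t ht =>
    Real.smoothTransition.zero_of_nonpos (by linarith)
  have hφ₁0 : φ₁ 0 = 0 := by simp [φ₁]
  have hφ₂1 : φ₂ 1 = 1 := Real.smoothTransition.one_of_one_le (by norm_num)
  let γ : ℝ → ℂ := fun t => γ₁ (φ₁ t) + γ₂ (φ₂ t) - y
  have hγl : ∀ t, t ≤ 1 / 2 → γ t = γ₁ (φ₁ t) := fun t ht => by
    simp [γ, hc₂ t ht, h₂.2.1]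
  have hγr : ∀ t, 1 / 2 ≤ t → γ t = γ₂ (φ₂ t) := fun t ht => by
    simp [γ, hc₁ t ht, h₁.2.2.1]
  have hγC : ContDiff ℝ 1 γ :=
    ((h₁.1.comp_contDiff hφ₁ hI₁).add (h₂.1.comp_contDiff hφ₂ hI₂)).sub contDiff_const
  have hγU : ∀ t, γ t ∈ U := fun t => by
    rcases le_total t (1 / 2) with h | h
    · rw [hγl t h]; exact h₁.2.2.2 _ (hI₁ t)
    · rw [hγr t h]; exact h₂.2.2.2 _ (hI₂ t)
  refine ⟨γ, ⟨hγC.contDiffOn, ?_, ?_, fun t _ => hγU t⟩, ?_⟩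
  · rw [hγl 0 (by norm_num), hφ₁0, h₁.2.1]
  · rw [hγr 1 (by norm_num), hφ₂1, h₂.2.2.1]
  have hcont : Continuous fun t => qhDensity U (γ t) * ‖deriv γ t‖ :=
    ((continuousOn_qhDensity hU hne).comp_continuous hγC.continuous hγU).mul
      (hγC.continuous_deriv le_rfl).norm
  have half : ∀ {a b : ℝ} {φ : ℝ → ℝ} {β : ℝ → ℂ} {p q : ℂ}, a ≤ b → β ∈ curvesIn U p q →
      ContDiff ℝ 1 φ → Monotone φ → (∀ t, φ t ∈ Icc (0:ℝ) 1) → φ a = 0 → φ b = 1 →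
      (∀ t ∈ Ioo a b, γ t = β (φ t)) →
      ∫ t in a..b, qhDensity U (γ t) * ‖deriv γ t‖ = curveLen (qhDensity U) β := by
    intro a b φ β p q hab hβ hφ hmono hI h0 h1 heq
    have hV := continuousOn_qhSpeed hU hne hβ
    rw [curveLen_eq_integral_qhSpeed, ← h0, ← h1]
    rw [← intervalIntegral.integral_comp_mul_deriv' (f' := deriv φ)
      (fun t _ => (hφ.differentiable one_ne_zero t).hasDerivAt)
      (hφ.continuous_deriv le_rfl).continuousOn
      (hV.mono (by rintro _ ⟨t, -, rfl⟩; exact hI t))]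
    refine intervalIntegral.integral_congr_Ioo_of_le hab fun t ht => ?_
    have hev : γ =ᶠ[𝓝 t] β ∘ φ := by
      filter_upwards [Ioo_mem_nhds ht.1 ht.2] with s hs using heq s hs
    have hβd : HasDerivWithinAt β (derivWithin β (Icc 0 1) (φ t)) (Icc 0 1) (φ t) :=
      ((hβ.1.differentiableOn one_ne_zero) _ (hI t)).hasDerivWithinAt
    have hd := hβd.scomp_hasDerivAt t (hφ.differentiable one_ne_zero t).hasDerivAt hI
    have hφ' : 0 ≤ deriv φ t := hmono.deriv_nonneg
    simp only [Function.comp, qhSpeed]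
    rw [hev.deriv_eq, hd.deriv, norm_smul, Real.norm_of_nonneg hφ', heq t ht]
    ring
  unfold curveLen at half ⊢
  rw [← intervalIntegral.integral_add_adjacent_intervals (hcont.intervalIntegrable 0 (1 / 2))
    (hcont.intervalIntegrable (1 / 2) 1)]
  rw [half (by norm_num) h₁ hφ₁ hm₁ hI₁ hφ₁0 (hc₁ _ le_rfl) (fun t ht => hγl t ht.2.le),
    half (by norm_num) h₂ hφ₂ hm₂ hI₂ (hc₂ _ le_rfl) hφ₂1 (fun t ht => hγr t ht.1.le)]

theorem CurveJoined.trans (hU : IsOpen U) (hne : Uᶜ.Nonempty) (h₁ : CurveJoined U x y)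
    (h₂ : CurveJoined U y z) : CurveJoined U x z := by
  obtain ⟨γ₁, h₁⟩ := h₁
  obtain ⟨γ₂, h₂⟩ := h₂
  obtain ⟨γ, h, -⟩ := exists_concat_curve hU hne h₁ h₂
  exact ⟨γ, h⟩

theorem qhDist_triangle (hU : IsOpen U) (hne : Uᶜ.Nonempty) (h₁ : CurveJoined U x y)
    (h₂ : CurveJoined U y z) : qhDist U x z ≤ qhDist U x y + qhDist U y z := by
  refine le_of_forall_pos_lt_add fun ε hε => ?_
  obtain ⟨γ₁, h₁, hl₁⟩ := h₁.exists_curveLen_lt (half_pos hε)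
  obtain ⟨γ₂, h₂, hl₂⟩ := h₂.exists_curveLen_lt (half_pos hε)
  obtain ⟨γ, h, hl⟩ := exists_concat_curve hU hne h₁ h₂
  have := qhDist_le_curveLen h
  linarith

theorem isPseudoDistOn_qhDist (hU : IsOpen U) (hne : Uᶜ.Nonempty) {S : Set ℂ}
    (hS : ∀ x ∈ S, ∀ y ∈ S, CurveJoined U x y) : IsPseudoDistOn S (qhDist U) :=
  ⟨fun x hx => qhDist_self (hS x hx x hx).left_mem, fun x _ y _ => qhDist_nonneg U x y,
    fun x _ y _ => qhDist_comm U x y,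
    fun x hx y hy z hz => qhDist_triangle hU hne (hS x hx y hy) (hS y hy z hz)⟩

/-- Euclidean segments close to a point stay in `U` and have controlled length. -/
theorem curveJoined_and_qhDist_le_of_dist_lt {w : ℂ} (h : dist z w < infDist z Uᶜ) :
    CurveJoined U z w ∧ qhDist U z w ≤ dist z w / (infDist z Uᶜ - dist z w) := by
  let γ : ℝ → ℂ := fun t => z + (t : ℂ) * (w - z)
  have hd : ∀ t : ℝ, HasDerivAt γ (w - z) t := fun t => by
    have := ((Complex.ofRealCLM.hasDerivAt (x := t)).mul_const (w - z)).const_add z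
    simp only [Complex.ofRealCLM_apply, Complex.ofReal_one, one_mul] at this
    exact this
  have hδ : ∀ t ∈ Icc (0:ℝ) 1, infDist z Uᶜ - dist z w ≤ infDist (γ t) Uᶜ := fun t ht => by
    have h1 : infDist z Uᶜ ≤ infDist (γ t) Uᶜ + dist z (γ t) := infDist_le_infDist_add_dist
    have h2 : dist z (γ t) ≤ dist z w := by
      rw [dist_eq_norm, dist_eq_norm, norm_sub_rev z w, sub_add_cancel_left, norm_neg, norm_mul,
        Complex.norm_real, Real.norm_of_nonneg ht.1]
      exact mul_le_of_le_one_left (norm_nonneg _) ht.2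
    linarith
  have hpos : 0 < infDist z Uᶜ - dist z w := sub_pos.2 h
  have hγ : γ ∈ curvesIn U z w := by
    refine ⟨ContDiff.contDiffOn ?_, by simp [γ], by simp [γ], fun t ht =>
      mem_of_infDist_compl_pos (hpos.trans_le (hδ t ht))⟩
    exact contDiff_const.add (Complex.ofRealCLM.contDiff.mul contDiff_const)
  refine ⟨⟨γ, hγ⟩, (qhDist_le_curveLen hγ).trans ?_⟩
  have hb : ∀ t ∈ Ι (0:ℝ) 1, ‖qhDensity U (γ t) * ‖deriv γ t‖‖ ≤
      dist z w / (infDist z Uᶜ - dist z w) := fun t ht => by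
    rw [uIoc_of_le zero_le_one] at ht
    rw [Real.norm_of_nonneg (mul_nonneg (qhDensity_nonneg _ _) (norm_nonneg _)), (hd t).deriv,
      dist_comm z w, dist_eq_norm w z, div_eq_inv_mul, ← dist_eq_norm, dist_comm w z]
    gcongr
    exact inv_anti₀ hpos (hδ t ⟨ht.1.le, ht.2⟩)
  have := intervalIntegral.norm_integral_le_of_norm_le_const hb
  rw [sub_zero, abs_one, mul_one] at this
  exact (le_abs_self _).trans this

/-- Infinitesimal comparison of the quasihyperbolic and the Euclidean distances. -/
theorem eventually_qhDist_le (hU : IsOpen U) (hne : Uᶜ.Nonempty) (hz : z ∈ U) {ε : ℝ}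
    (hε : 0 < ε) :
    ∀ᶠ w in 𝓝 z, CurveJoined U z w ∧ qhDist U z w ≤ (qhDensity U z + ε) * ‖w - z‖ := by
  have hpos := infDist_compl_pos hU hne hz
  have h1 : ∀ᶠ w in 𝓝 z, dist z w < infDist z Uᶜ :=
    (continuous_const.dist continuous_id).continuousAt.eventually_lt continuousAt_const (by simpa)
  have h2 : ∀ᶠ w in 𝓝 z, (infDist z Uᶜ - dist z w)⁻¹ < qhDensity U z + ε := by
    have hc : ContinuousAt (fun w => (infDist z Uᶜ - dist z w)⁻¹) z :=
      (continuous_const.sub (continuous_const.dist continuous_id)).continuousAt.inv₀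
        (by simpa using hpos.ne')
    refine hc.eventually_lt continuousAt_const ?_
    simpa [qhDensity] using hε
  filter_upwards [h1, h2] with w hw1 hw2
  obtain ⟨h3, h4⟩ := curveJoined_and_qhDist_le_of_dist_lt hw1
  refine ⟨h3, h4.trans ?_⟩
  rw [div_eq_inv_mul, ← dist_eq_norm, dist_comm w z]
  gcongr

theorem curveJoined_of_isPreconnected (hU : IsOpen U) (hne : Uᶜ.Nonempty) {T : Set ℂ}
    (hT : IsPreconnected T) (hTU : T ⊆ U) (hx : x ∈ T) (hy : y ∈ T) : CurveJoined U x y :=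
  hT.induction₂ (CurveJoined U)
    (fun _ hz => eventually_nhdsWithin_of_eventually_nhds <|
      (eventually_qhDist_le hU hne (hTU hz) one_pos).mono fun _ h => h.1)
    (fun _ _ _ _ _ _ h₁ h₂ => h₁.trans hU hne h₂) (fun _ _ _ _ h => h.symm) hx hy

/-- A function whose local Lipschitz constant is bounded by the quasihyperbolic density grows along
a curve at most as fast as the quasihyperbolic length. -/
theorem sub_le_integral_qhSpeed (hU : IsOpen U) (hne : Uᶜ.Nonempty) {H : ℂ → ℝ}
    (hH : ∀ z ∈ U, ∀ ε > 0, ∀ᶠ w in 𝓝 z, |H w - H z| ≤ (qhDensity U z + ε) * ‖w - z‖)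
    (hγ : γ ∈ curvesIn U x y) {a b : ℝ} (ha : 0 ≤ a) (hab : a ≤ b) (hb : b ≤ 1) :
    H (γ b) - H (γ a) ≤ ∫ t in a..b, qhSpeed U γ t := by
  have hsub : Icc a b ⊆ Icc 0 1 := Icc_subset_Icc ha hb
  let W : ℝ → ℝ := IccExtend zero_le_one ((Icc (0:ℝ) 1).domRestrict (qhSpeed U γ))
  have hWc : Continuous W :=
    (continuousOn_iff_continuous_domRestrict.1 (continuousOn_qhSpeed hU hne hγ)).Icc_extend'
  have hWe : ∀ t ∈ Icc (0:ℝ) 1, W t = qhSpeed U γ t := fun t ht => by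
    rw [show W t = _ from IccExtend_of_mem _ _ ht]
    rfl
  have hHc : ContinuousOn H U := by
    intro z hz
    refine ContinuousAt.continuousWithinAt ?_
    rw [ContinuousAt, tendsto_iff_norm_sub_tendsto_zero]
    have h0 : Tendsto (fun w => (qhDensity U z + 1) * ‖w - z‖) (𝓝 z) (𝓝 0) := by
      have : Continuous fun w => (qhDensity U z + 1) * ‖w - z‖ := by fun_prop
      simpa using this.tendsto z
    exact squeeze_zero' (Eventually.of_forall fun _ => norm_nonneg _) (hH z hz 1 one_pos) h0
  have hBd : ∀ t, HasDerivAt (fun t => ∫ s in a..t, W s) (W t) t := fun t =>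
    intervalIntegral.integral_hasDerivAt_right (hWc.intervalIntegrable _ _)
      (hWc.stronglyMeasurableAtFilter _ _) hWc.continuousAt
  have main : H (γ b) - H (γ a) ≤ ∫ s in a..b, W s := by
    refine image_le_of_liminf_slope_right_le_deriv_boundary (a := a) (b := b)
      (f := fun t => H (γ t) - H (γ a)) (B := fun t => ∫ s in a..t, W s) (B' := W)
      ?_ (by simp) (fun t _ => (hBd t).continuousAt.continuousWithinAt)
      (fun t _ => (hBd t).hasDerivWithinAt) ?_ ⟨hab, le_rfl⟩
    · exact ((hHc.comp hγ.1.continuousOn hγ.2.2.2).mono hsub).sub continuousOn_const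
    · intro t ht r hr
      have htI : t ∈ Icc (0:ℝ) 1 := hsub ⟨ht.1, ht.2.le⟩
      rw [hWe t htI, qhSpeed] at hr
      set v := derivWithin γ (Icc 0 1) t
      have hv : HasDerivWithinAt γ v (Icc 0 1) t :=
        ((hγ.1.differentiableOn one_ne_zero) t htI).hasDerivWithinAt
      have hle : 𝓝[>] t ≤ 𝓝[Icc 0 1] t :=
        nhdsWithin_le_iff.2 (mem_of_superset (Ioo_mem_nhdsGT (ht.2.trans_le hb))
          fun s hs => ⟨htI.1.trans hs.1.le, hs.2.le⟩)
      have hv' : HasDerivWithinAt γ v (Ioi t) t := hv.mono_of_mem_nhdsWithin (hle self_mem_nhdsWithin)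
      have hs : Tendsto (slope γ t) (𝓝[>] t) (𝓝 v) :=
        (hasDerivWithinAt_iff_tendsto_slope' (by simp)).1 hv'
      obtain ⟨ε, hε, hεr⟩ : ∃ ε > 0, (qhDensity U (γ t) + ε) * ‖v‖ < r := by
        have hc : Continuous fun ε : ℝ => (qhDensity U (γ t) + ε) * ‖v‖ := by fun_prop
        have : ∀ᶠ ε in 𝓝[>] (0:ℝ), (qhDensity U (γ t) + ε) * ‖v‖ < r :=
          eventually_nhdsWithin_of_eventually_nhds
            (hc.continuousAt.eventually_lt continuousAt_const (by simpa using hr))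
        exact (this.and self_mem_nhdsWithin).exists.imp fun ε h => ⟨h.2, h.1⟩
      have h1 : ∀ᶠ s in 𝓝[>] t, (qhDensity U (γ t) + ε) * ‖slope γ t s‖ < r :=
        (hs.norm.const_mul _).eventually (gt_mem_nhds hεr)
      have h2 := hv'.continuousWithinAt.tendsto.eventually (hH _ (hγ.2.2.2 t htI) ε hε)
      refine Eventually.frequently ?_
      filter_upwards [h1, h2, self_mem_nhdsWithin] with s hs1 hs2 hs3
      refine lt_of_le_of_lt ?_ hs1
      have hst : 0 < s - t := sub_pos.2 hs3
      rw [slope_def_field, slope_def_module, norm_smul, Real.norm_of_nonneg (inv_nonneg.2 hst.le),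
        div_eq_inv_mul, mul_left_comm]
      gcongr
      calc H (γ s) - H (γ a) - (H (γ t) - H (γ a)) = H (γ s) - H (γ t) := by ring
        _ ≤ _ := (le_abs_self _).trans hs2
  refine main.trans_eq (intervalIntegral.integral_congr fun t ht => hWe t ?_)
  rw [uIcc_of_le hab] at ht
  exact hsub ht

theorem abs_sub_le_qhDist (hU : IsOpen U) (hne : Uᶜ.Nonempty) {H : ℂ → ℝ}
    (hH : ∀ z ∈ U, ∀ ε > 0, ∀ᶠ w in 𝓝 z, |H w - H z| ≤ (qhDensity U z + ε) * ‖w - z‖)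
    (h : CurveJoined U x y) : |H y - H x| ≤ qhDist U x y := by
  have key : ∀ x y, CurveJoined U x y → H y - H x ≤ qhDist U x y := fun x y h => by
    refine le_of_forall_pos_lt_add fun ε hε => ?_
    obtain ⟨γ, hγ, hl⟩ := h.exists_curveLen_lt hε
    have := sub_le_integral_qhSpeed hU hne hH hγ le_rfl zero_le_one le_rfl
    rw [hγ.2.1, hγ.2.2.1, ← curveLen_eq_integral_qhSpeed] at this
    linarith
  refine abs_le.2 ⟨?_, key x y h⟩
  have := key y x h.symm
  rw [qhDist_comm] at this
  linarith

theorem qhDist_eq_zero_of_not_curveJoined (h : ¬ CurveJoined U x y) : qhDist U x y = 0 := by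
  rw [qhDist_eq_sInf, not_nonempty_iff_eq_empty.1 h, image_empty, Real.sInf_empty]

theorem eventually_abs_qhDist_sub_le (hU : IsOpen U) (hne : Uᶜ.Nonempty) (x : ℂ) (hz : z ∈ U)
    {ε : ℝ} (hε : 0 < ε) :
    ∀ᶠ w in 𝓝 z, |qhDist U x w - qhDist U x z| ≤ (qhDensity U z + ε) * ‖w - z‖ := by
  filter_upwards [eventually_qhDist_le hU hne hz hε] with w ⟨hw, hl⟩
  refine le_trans ?_ hl
  by_cases hx : CurveJoined U x z
  · have h1 := qhDist_triangle hU hne hx hw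
    have h2 := qhDist_triangle hU hne (hx.trans hU hne hw) hw.symm
    rw [qhDist_comm U w z] at h2
    exact abs_le.2 ⟨by linarith, by linarith⟩
  · rw [qhDist_eq_zero_of_not_curveJoined hx,
      qhDist_eq_zero_of_not_curveJoined fun h => hx (h.trans hU hne hw.symm)]
    simpa using qhDist_nonneg U z w

/-- A Euclidean contraction that does not decrease the distance to the complement is a contraction
for the quasihyperbolic distances. -/
theorem qhDist_map_le (hU : IsOpen U) (hneU : Uᶜ.Nonempty) (hV : IsOpen V) (hneV : Vᶜ.Nonempty)
    {φ : ℂ → ℂ} (hφ : LipschitzWith 1 φ) (hδ : ∀ z ∈ U, infDist z Uᶜ ≤ infDist (φ z) Vᶜ)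
    (h : CurveJoined U x y) :
    CurveJoined V (φ x) (φ y) ∧ qhDist V (φ x) (φ y) ≤ qhDist U x y := by
  have hφV : ∀ z ∈ U, φ z ∈ V := fun z hz =>
    mem_of_infDist_compl_pos ((infDist_compl_pos hU hneU hz).trans_le (hδ z hz))
  constructor
  · obtain ⟨γ, hγ⟩ := h
    refine curveJoined_of_isPreconnected hV hneV (T := (φ ∘ γ) '' Icc 0 1)
      (isPreconnected_Icc.image _ (hφ.continuous.comp_continuousOn hγ.1.continuousOn)) ?_
      ⟨0, by simp, by simp [hγ.2.1]⟩ ⟨1, by simp, by simp [hγ.2.2.1]⟩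
    rintro _ ⟨t, ht, rfl⟩
    exact hφV _ (hγ.2.2.2 t ht)
  · have hH : ∀ z ∈ U, ∀ ε > 0, ∀ᶠ w in 𝓝 z,
        |qhDist V (φ x) (φ w) - qhDist V (φ x) (φ z)| ≤ (qhDensity U z + ε) * ‖w - z‖ := by
      intro z hz ε hε
      filter_upwards [hφ.continuous.continuousAt.eventually
        (eventually_abs_qhDist_sub_le hV hneV (φ x) (hφV z hz) hε)] with w hw
      refine hw.trans ?_
      have h1 : ‖φ w - φ z‖ ≤ ‖w - z‖ := by
        simpa [dist_eq_norm] using hφ.dist_le_mul w z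
      have h2 : qhDensity V (φ z) ≤ qhDensity U z :=
        inv_anti₀ (infDist_compl_pos hU hneU hz) (hδ z hz)
      have h3 : 0 ≤ qhDensity U z + ε := add_nonneg (qhDensity_nonneg U z) hε.le
      gcongr
    have := abs_sub_le_qhDist hU hneU hH h
    rw [qhDist_self (hφV x h.left_mem), sub_zero] at this
    exact (le_abs_self _).trans this

/-- Subarcs of curves. -/
theorem curveJoined_subarc (hU : IsOpen U) (hne : Uᶜ.Nonempty) (hγ : γ ∈ curvesIn U x y)
    {a b : ℝ} (ha : a ∈ Icc (0:ℝ) 1) (hb : b ∈ Icc (0:ℝ) 1) : CurveJoined U (γ a) (γ b) := by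
  refine curveJoined_of_isPreconnected hU hne (T := γ '' Icc 0 1)
    (isPreconnected_Icc.image _ hγ.1.continuousOn) ?_ ⟨a, ha, rfl⟩ ⟨b, hb, rfl⟩
  rintro _ ⟨t, ht, rfl⟩
  exact hγ.2.2.2 t ht

theorem qhDist_le_integral_qhSpeed (hU : IsOpen U) (hne : Uᶜ.Nonempty) (hγ : γ ∈ curvesIn U x y)
    {a b : ℝ} (ha : 0 ≤ a) (hab : a ≤ b) (hb : b ≤ 1) :
    qhDist U (γ a) (γ b) ≤ ∫ t in a..b, qhSpeed U γ t := by
  have := sub_le_integral_qhSpeed hU hne (H := qhDist U (γ a))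
    (fun z hz ε hε => eventually_abs_qhDist_sub_le hU hne _ hz hε) hγ ha hab hb
  rwa [qhDist_self (hγ.2.2.2 a ⟨ha, hab.trans hb⟩), sub_zero] at this

/-- A curve can be cut at an interior point. -/
theorem qhDist_add_le_curveLen (hU : IsOpen U) (hne : Uᶜ.Nonempty) (hγ : γ ∈ curvesIn U x y)
    {t : ℝ} (ht : t ∈ Icc (0:ℝ) 1) :
    qhDist U x (γ t) + qhDist U (γ t) y ≤ curveLen (qhDensity U) γ := by
  have h1 := qhDist_le_integral_qhSpeed hU hne hγ le_rfl ht.1 ht.2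
  have h2 := qhDist_le_integral_qhSpeed hU hne hγ ht.1 ht.2 le_rfl
  rw [hγ.2.1] at h1
  rw [hγ.2.2.1] at h2
  rw [curveLen_eq_integral_qhSpeed, ← intervalIntegral.integral_add_adjacent_intervals
    (intervalIntegrable_qhSpeed hU hne hγ (by simp) ht)
    (intervalIntegrable_qhSpeed hU hne hγ ht (by simp))]
  exact add_le_add h1 h2

theorem eventually_abs_log_sub_log_le (hU : IsOpen U) (hne : Uᶜ.Nonempty) {h : ℂ → ℝ}
    (hl : ∀ z w, |h w - h z| ≤ ‖w - z‖) (hz : z ∈ U) (hδ : infDist z Uᶜ ≤ h z) {ε : ℝ}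
    (hε : 0 < ε) :
    ∀ᶠ w in 𝓝 z, |Real.log (h w) - Real.log (h z)| ≤ (qhDensity U z + ε) * ‖w - z‖ := by
  have hpos := (infDist_compl_pos hU hne hz).trans_le hδ
  have hq : (h z)⁻¹ ≤ qhDensity U z := inv_anti₀ (infDist_compl_pos hU hne hz) hδ
  have hc : ContinuousAt (fun w => h z - ‖w - z‖) z := by fun_prop
  have h1 : ∀ᶠ w in 𝓝 z, 0 < h z - ‖w - z‖ :=
    continuousAt_const.eventually_lt hc (by simpa using hpos)
  have h2 : ∀ᶠ w in 𝓝 z, (h z - ‖w - z‖)⁻¹ < qhDensity U z + ε := by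
    refine (hc.inv₀ (by simpa using hpos.ne')).eventually_lt continuousAt_const ?_
    simpa using lt_add_of_le_of_pos hq hε
  filter_upwards [h1, h2] with w hw1 hw2
  have hlw := abs_le.1 (hl z w)
  have hmin : 0 < h w := by linarith
  have key : ∀ a b : ℝ, h z - ‖w - z‖ ≤ a → |b - a| ≤ ‖w - z‖ → 0 < b →
      Real.log b - Real.log a ≤ (h z - ‖w - z‖)⁻¹ * ‖w - z‖ := by
    intro a b ha hab hb
    have ha0 : 0 < a := hw1.trans_le ha
    rw [← Real.log_div hb.ne' ha0.ne']
    calc Real.log (b / a) ≤ b / a - 1 := Real.log_le_sub_one_of_pos (div_pos hb ha0)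
      _ = a⁻¹ * (b - a) := by field_simp
      _ ≤ a⁻¹ * ‖w - z‖ := by gcongr; exact (le_abs_self _).trans hab
      _ ≤ _ := by gcongr
  have e1 := key (h z) (h w) (by linarith [norm_nonneg (w - z)]) (hl z w) hmin
  have e2 := key (h w) (h z) (by linarith) (by rw [abs_sub_comm]; exact hl z w) hpos
  refine (abs_le.2 ⟨by linarith, e1⟩).trans ?_
  gcongr

/-- Logarithmic lower bounds for the quasihyperbolic distance. -/
theorem abs_log_sub_log_le_qhDist (hU : IsOpen U) (hne : Uᶜ.Nonempty) {h : ℂ → ℝ}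
    (hl : ∀ z w, |h w - h z| ≤ ‖w - z‖) (hδ : ∀ z ∈ U, infDist z Uᶜ ≤ h z)
    (hxy : CurveJoined U x y) : |Real.log (h y) - Real.log (h x)| ≤ qhDist U x y :=
  abs_sub_le_qhDist hU hne
    (fun z hz _ hε => eventually_abs_log_sub_log_le hU hne hl hz (hδ z hz) hε) hxy

theorem dist_le_of_qhDist_le (hU : IsOpen U) (hne : Uᶜ.Nonempty) (hxy : CurveJoined U x y)
    {L : ℝ} (hL : qhDist U x y ≤ L) : dist y x ≤ infDist x Uᶜ * (Real.exp L - 1) := by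
  have hx := infDist_compl_pos hU hne hxy.left_mem
  have key := abs_log_sub_log_le_qhDist hU hne (h := fun z => infDist x Uᶜ + dist z x)
    (fun z w => by
      rw [add_sub_add_left_eq_sub, ← dist_eq_norm]
      exact abs_dist_sub_le w z x)
    (fun z _ => infDist_le_infDist_add_dist) hxy
  simp only [dist_self, add_zero] at key
  have h1 : Real.log (infDist x Uᶜ + dist y x) ≤ Real.log (infDist x Uᶜ) + L := by
    linarith [(abs_le.1 key).2]
  have h2 := Real.exp_le_exp.2 h1
  rw [Real.exp_log (by positivity), Real.exp_add, Real.exp_log hx] at h2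
  linarith

theorem infDist_ge_of_qhDist_le (hU : IsOpen U) (hne : Uᶜ.Nonempty) (hxy : CurveJoined U x y)
    {L : ℝ} (hL : qhDist U x y ≤ L) : infDist x Uᶜ * Real.exp (-L) ≤ infDist y Uᶜ := by
  have hx := infDist_compl_pos hU hne hxy.left_mem
  have hy := infDist_compl_pos hU hne hxy.right_mem
  have key := abs_log_sub_log_le_qhDist hU hne (h := fun z => infDist z Uᶜ)
    (fun z w => by
      rw [← dist_eq_norm, ← Real.dist_eq]
      simpa using (lipschitz_infDist_pt Uᶜ).dist_le_mul w z)
    (fun z _ => le_rfl) hxy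
  have h1 : Real.log (infDist x Uᶜ) + -L ≤ Real.log (infDist y Uᶜ) := by
    linarith [(abs_le.1 key).1]
  have h2 := Real.exp_le_exp.2 h1
  rwa [Real.exp_log hy, Real.exp_add, Real.exp_log hx] at h2

theorem eq_of_qhDist_eq_zero (hU : IsOpen U) (hne : Uᶜ.Nonempty) (hxy : CurveJoined U x y)
    (h : qhDist U x y ≤ 0) : y = x := by
  have := dist_le_of_qhDist_le hU hne hxy h
  simpa using this

theorem tendsto_qhDist_self (hU : IsOpen U) (hne : Uᶜ.Nonempty) (hz : z ∈ U) :
    Tendsto (qhDist U z) (𝓝 z) (𝓝 0) := by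
  have h0 : Tendsto (fun w => (qhDensity U z + 1) * ‖w - z‖) (𝓝 z) (𝓝 0) := by
    have : Continuous fun w => (qhDensity U z + 1) * ‖w - z‖ := by fun_prop
    simpa using this.tendsto z
  exact squeeze_zero' (Eventually.of_forall fun _ => qhDist_nonneg _ _ _)
    ((eventually_qhDist_le hU hne hz one_pos).mono fun _ h => h.2) h0

/-- Points at bounded quasihyperbolic distance from `x` lie in a compact subset of `U`. -/
theorem exists_isCompact_of_qhDist_le (hU : IsOpen U) (hne : Uᶜ.Nonempty) (hx : x ∈ U) (L : ℝ) :
    ∃ K ⊆ U, IsCompact K ∧ ∀ y, CurveJoined U x y → qhDist U x y ≤ L → y ∈ K := by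
  have hpos := infDist_compl_pos hU hne hx
  refine ⟨closedBall x (infDist x Uᶜ * (Real.exp L - 1)) ∩
    {w | infDist x Uᶜ * Real.exp (-L) ≤ infDist w Uᶜ}, ?_, ?_, ?_⟩
  · rintro w ⟨-, hw⟩
    exact mem_of_infDist_compl_pos ((mul_pos hpos (Real.exp_pos _)).trans_le hw)
  · exact (isCompact_closedBall _ _).inter_right
      (isClosed_le continuous_const (continuous_infDist_pt _))
  · intro y hxy hL
    exact ⟨dist_le_of_qhDist_le hU hne hxy hL, infDist_ge_of_qhDist_le hU hne hxy hL⟩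

/-- Parametrization of a curve proportionally to its quasihyperbolic length. -/
theorem exists_proportional_parametrization (hU : IsOpen U) (hne : Uᶜ.Nonempty)
    (hγ : γ ∈ curvesIn U x y) :
    ∃ g : ℝ → ℂ, ∀ s ∈ Icc (0:ℝ) 1, CurveJoined U x (g s) ∧
      qhDist U x (g s) ≤ s * curveLen (qhDensity U) γ ∧
      qhDist U (g s) y ≤ (1 - s) * curveLen (qhDensity U) γ ∧
      ∀ t ∈ Icc (0:ℝ) 1, qhDist U (g s) (g t) ≤ |s - t| * curveLen (qhDensity U) γ := by
  set L := curveLen (qhDensity U) γ with hLdef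
  have hL0 : 0 ≤ L := curveLen_nonneg U γ
  let B : ℝ → ℝ := fun t => ∫ s in (0:ℝ)..t, qhSpeed U γ s
  have hB0 : B 0 = 0 := intervalIntegral.integral_same
  have hB1 : B 1 = L := (curveLen_eq_integral_qhSpeed U γ).symm
  have hBc : ContinuousOn B (Icc 0 1) := by
    have := intervalIntegral.continuousOn_primitive_interval (a := (0:ℝ)) (b := 1)
      (f := qhSpeed U γ) (μ := MeasureTheory.volume)
      (by
        rw [uIcc_of_le zero_le_one]
        exact (continuousOn_qhSpeed hU hne hγ).integrableOn_Icc)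
    rwa [uIcc_of_le zero_le_one] at this
  have hBd : ∀ a ∈ Icc (0:ℝ) 1, ∀ b ∈ Icc (0:ℝ) 1, qhDist U (γ a) (γ b) ≤ |B a - B b| := by
    have key : ∀ a ∈ Icc (0:ℝ) 1, ∀ b ∈ Icc (0:ℝ) 1, a ≤ b →
        qhDist U (γ a) (γ b) ≤ B b - B a := fun a ha b hb hab => by
      refine (qhDist_le_integral_qhSpeed hU hne hγ ha.1 hab hb.2).trans_eq ?_
      exact (intervalIntegral.integral_interval_sub_left
        (intervalIntegrable_qhSpeed hU hne hγ (by simp) hb)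
        (intervalIntegrable_qhSpeed hU hne hγ (by simp) ha)).symm
    intro a ha b hb
    rcases le_total a b with h | h
    · rw [abs_sub_comm]
      exact (key a ha b hb h).trans (le_abs_self _)
    · rw [qhDist_comm]
      exact (key b hb a ha h).trans (le_abs_self _)
  have hτ : ∀ s, ∃ τ, s ∈ Icc (0:ℝ) 1 → τ ∈ Icc (0:ℝ) 1 ∧ B τ = s * L := by
    intro s
    by_cases hs : s ∈ Icc (0:ℝ) 1
    · have : s * L ∈ Icc (B 0) (B 1) := by
        rw [hB0, hB1]
        exact ⟨mul_nonneg hs.1 hL0, mul_le_of_le_one_left hL0 hs.2⟩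
      obtain ⟨τ, h1, h2⟩ := intermediate_value_Icc zero_le_one hBc this
      exact ⟨τ, fun _ => ⟨h1, h2⟩⟩
    · exact ⟨0, fun h => absurd h hs⟩
  choose τ hτ using hτ
  refine ⟨γ ∘ τ, fun s hs => ?_⟩
  obtain ⟨hs1, hs2⟩ := hτ s hs
  refine ⟨?_, ?_, ?_, fun t ht => ?_⟩
  · simpa [hγ.2.1] using curveJoined_subarc hU hne hγ (a := 0) (by simp) hs1
  · have := hBd 0 (by simp) (τ s) hs1
    rw [hγ.2.1, hB0, hs2, zero_sub, abs_neg, abs_of_nonneg (mul_nonneg hs.1 hL0)] at this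
    exact this
  · have := hBd (τ s) hs1 1 (by simp)
    rw [hγ.2.2.1, hB1, hs2, abs_sub_comm, ← one_sub_mul,
      abs_of_nonneg (mul_nonneg (sub_nonneg.2 hs.2) hL0)] at this
    exact this
  · obtain ⟨ht1, ht2⟩ := hτ t ht
    have := hBd (τ s) hs1 (τ t) ht1
    rwa [hs2, ht2, ← sub_mul, abs_mul, abs_of_nonneg hL0] at this

/-- The quasihyperbolic metric is geodesic (on each component). -/
theorem exists_isGeodesicIn_qhDist (hU : IsOpen U) (hne : Uᶜ.Nonempty) (hxy : CurveJoined U x y) :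
    ∃ g, IsGeodesicIn U (qhDist U) g x y ∧
      ∀ t ∈ Icc 0 (qhDist U x y), CurveJoined U x (g t) := by
  have hxU := hxy.left_mem
  have hxx : CurveJoined U x x := hxy.trans hU hne hxy.symm
  set L := qhDist U x y with hL
  have hL0 : 0 ≤ L := qhDist_nonneg U x y
  rcases hL0.eq_or_lt with h0 | hpos
  · have hyx := eq_of_qhDist_eq_zero hU hne hxy h0.ge
    refine ⟨fun _ => x, ⟨rfl, hyx.symm, fun _ _ => hxU, fun s hs t ht => ?_⟩, fun _ _ => hxx⟩
    rw [← hL, ← h0] at hs ht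
    simp only [Icc_self, mem_singleton_iff] at hs ht
    simp [hs, ht, qhDist_self hxU]
  choose γ hγ hγl using fun n : ℕ =>
    hxy.exists_curveLen_lt (ε := 1 / ((n : ℝ) + 1)) Nat.one_div_pos_of_nat
  choose g hg using fun n => exists_proportional_parametrization hU hne (hγ n)
  set l : ℕ → ℝ := fun n => curveLen (qhDensity U) (γ n) with hl
  have hlL : ∀ n, L ≤ l n := fun n => qhDist_le_curveLen (hγ n)
  have hlim : Tendsto l atTop (𝓝 L) := by
    refine tendsto_of_tendsto_of_tendsto_of_le_of_le tendsto_const_nhds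
      (h := fun n : ℕ => L + 1 / ((n : ℝ) + 1)) ?_ hlL fun n => (hγl n).le
    simpa using tendsto_one_div_add_atTop_nhds_zero_nat.const_add L
  have hlim' : Tendsto l (hyperfilter ℕ : Filter ℕ) (𝓝 L) :=
    hlim.mono_left Nat.hyperfilter_le_atTop
  have hl1 : ∀ n, l n ≤ L + 1 := fun n => (hγl n).le.trans <| by
    have : 1 / ((n : ℝ) + 1) ≤ 1 := by
      rw [div_le_one (by positivity)]
      linarith [n.cast_nonneg (α := ℝ)]
    linarith
  obtain ⟨K, hKU, hK, hKm⟩ := exists_isCompact_of_qhDist_le hU hne hxU (L + 1)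
  have hp : ∀ s, ∃ p, s ∈ Icc (0:ℝ) 1 →
      p ∈ U ∧ Tendsto (fun n => g n s) (hyperfilter ℕ : Filter ℕ) (𝓝 p) := by
    intro s
    by_cases hs : s ∈ Icc (0:ℝ) 1
    · have hmem : ∀ n, g n s ∈ K := fun n => by
        obtain ⟨h1, h2, -⟩ := hg n s hs
        exact hKm _ h1 (h2.trans ((mul_le_of_le_one_left (hL0.trans (hlL n)) hs.2).trans (hl1 n)))
      obtain ⟨p, hpK, hp⟩ := hK.ultrafilter_le_nhds ((hyperfilter ℕ).map fun n => g n s)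
        (le_principal_iff.2 (Ultrafilter.mem_map.2 (Eventually.of_forall hmem)))
      exact ⟨p, fun _ => ⟨hKU hpK, hp⟩⟩
    · exact ⟨0, fun h => absurd h hs⟩
  choose p hp using hp
  have hJ : ∀ s ∈ Icc (0:ℝ) 1, CurveJoined U x (p s) := by
    intro s hs
    obtain ⟨n, hn⟩ := ((hp s hs).2.eventually
      (eventually_qhDist_le hU hne (hp s hs).1 one_pos)).exists
    exact (hg n s hs).1.trans hU hne hn.1.symm
  have hd : ∀ s ∈ Icc (0:ℝ) 1,
      Tendsto (fun n => qhDist U (p s) (g n s)) (hyperfilter ℕ : Filter ℕ) (𝓝 0) := fun s hs =>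
    (tendsto_qhDist_self hU hne (hp s hs).1).comp (hp s hs).2
  have htri : ∀ {a b c : ℂ}, CurveJoined U x a → CurveJoined U x b → CurveJoined U x c →
      qhDist U a c ≤ qhDist U a b + qhDist U b c := fun ha hb hc =>
    qhDist_triangle hU hne (ha.symm.trans hU hne hb) (hb.symm.trans hU hne hc)
  have h1 : ∀ s ∈ Icc (0:ℝ) 1, qhDist U x (p s) ≤ s * L := fun s hs => by
    refine ge_of_tendsto' (x := (hyperfilter ℕ : Filter ℕ))
      (f := fun n => s * l n + qhDist U (p s) (g n s)) ?_ fun n => ?_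
    · simpa using (hlim'.const_mul s).add (hd s hs)
    · have := htri hxx (hg n s hs).1 (hJ s hs)
      rw [qhDist_comm U (g n s)] at this
      linarith [(hg n s hs).2.1]
  have h2 : ∀ s ∈ Icc (0:ℝ) 1, qhDist U (p s) y ≤ (1 - s) * L := fun s hs => by
    refine ge_of_tendsto' (x := (hyperfilter ℕ : Filter ℕ))
      (f := fun n => (1 - s) * l n + qhDist U (p s) (g n s)) ?_ fun n => ?_
    · simpa using (hlim'.const_mul (1 - s)).add (hd s hs)
    · have := htri (hJ s hs) (hg n s hs).1 hxy
      linarith [(hg n s hs).2.2.1]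
  have h3 : ∀ s ∈ Icc (0:ℝ) 1, ∀ t ∈ Icc (0:ℝ) 1, qhDist U (p s) (p t) ≤ |s - t| * L := by
    intro s hs t ht
    refine ge_of_tendsto' (x := (hyperfilter ℕ : Filter ℕ))
      (f := fun n => |s - t| * l n + qhDist U (p s) (g n s) + qhDist U (p t) (g n t)) ?_
      fun n => ?_
    · simpa using ((hlim'.const_mul |s - t|).add (hd s hs)).add (hd t ht)
    · have e1 := htri (hJ s hs) (hg n s hs).1 (hJ t ht)
      have e2 := htri (hg n s hs).1 (hg n t ht).1 (hJ t ht)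
      rw [qhDist_comm U (g n t)] at e2
      linarith [(hg n s hs).2.2.2 t ht]
  have h4 : ∀ s ∈ Icc (0:ℝ) 1, ∀ t ∈ Icc (0:ℝ) 1, qhDist U (p s) (p t) = |s - t| * L := by
    have key : ∀ s ∈ Icc (0:ℝ) 1, ∀ t ∈ Icc (0:ℝ) 1, s ≤ t →
        qhDist U (p s) (p t) = |s - t| * L := fun s hs t ht hst => by
      refine le_antisymm (h3 s hs t ht) ?_
      have e1 := htri hxx (hJ s hs) hxy
      have e2 := htri (hJ s hs) (hJ t ht) hxy
      rw [abs_sub_comm, abs_of_nonneg (sub_nonneg.2 hst)]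
      linarith [h1 s hs, h2 t ht]
    intro s hs t ht
    rcases le_total s t with h | h
    · exact key s hs t ht h
    · rw [qhDist_comm, abs_sub_comm]
      exact key t ht s hs h
  have hdiv : ∀ s ∈ Icc 0 L, s / L ∈ Icc (0:ℝ) 1 := fun s hs =>
    ⟨div_nonneg hs.1 hL0, div_le_one_of_le₀ hs.2 hL0⟩
  refine ⟨fun s => p (s / L), ⟨?_, ?_, fun s hs => (hp _ (hdiv s hs)).1, fun s hs t ht => ?_⟩,
    fun s hs => hJ _ (hdiv s hs)⟩
  · have := h1 0 (by simp)
    rw [zero_mul] at this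
    simpa using eq_of_qhDist_eq_zero hU hne (hJ 0 (by simp)) this
  · have := h2 1 (by simp)
    rw [sub_self, zero_mul] at this
    have e := eq_of_qhDist_eq_zero hU hne ((hJ 1 (by simp)).symm.trans hU hne hxy) this
    rw [← hL]
    simp only [div_self hpos.ne', e]
  · rw [h4 _ (hdiv s hs) _ (hdiv t ht), ← sub_div, abs_div, abs_of_pos hpos,
      div_mul_cancel₀ _ hpos.ne']

/-- Gromov hyperbolicity gives the four point condition on the components. -/
theorem exists_fourPointOn_of_isGromovHyperbolic (hU : IsOpen U) (hne : Uᶜ.Nonempty)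
    (h : IsGromovHyperbolic U (qhDist U)) (x : ℂ) :
    ∃ δ, 0 ≤ δ ∧ FourPointOn {z | CurveJoined U x z} (qhDist U) δ := by
  obtain ⟨δ, hδ, hH⟩ := h
  have hJ : ∀ z ∈ {z | CurveJoined U x z}, ∀ w ∈ {z | CurveJoined U x z}, CurveJoined U z w :=
    fun z hz w hw => CurveJoined.trans hU hne (CurveJoined.symm hz) hw
  refine ⟨6 * δ + 2, by positivity, fourPointOn_of_thin hH (fun z hz => CurveJoined.right_mem hz)
    (isPseudoDistOn_qhDist hU hne hJ) (fun z hz w hw => ?_) hδ⟩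
  obtain ⟨g, hg, hg'⟩ := exists_isGeodesicIn_qhDist hU hne (hJ z hz w hw)
  exact ⟨g, hg, fun t ht => CurveJoined.trans hU hne hz (hg' t ht)⟩

end QuasiHyperbolic

section Fold

variable {a : ℝ} {z w e : ℂ}

/-- The folding map onto the quadrant `{re ≥ a, im ≥ 0}`: reflect the half plane `{re ≥ a}` in the
real axis and collapse the half plane `{re ≤ a}` radially to the ray from `a` going up. -/
def fold (a : ℝ) (z : ℂ) : ℂ := ⟨a + max (z.re - a) 0, ‖(⟨min (z.re - a) 0, z.im⟩ : ℂ)‖⟩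

theorem fold_of_le_re (h : a ≤ z.re) : fold a z = ⟨z.re, |z.im|⟩ := by
  rw [fold, max_eq_left (sub_nonneg.2 h), min_eq_right (sub_nonneg.2 h), add_sub_cancel]
  congr 1
  exact (Complex.abs_im_eq_norm.2 rfl).symm

theorem fold_of_re_le (h : z.re ≤ a) : fold a z = ⟨a, ‖z - a‖⟩ := by
  rw [fold, max_eq_right (sub_nonpos.2 h), min_eq_left (sub_nonpos.2 h), add_zero]
  congr 2
  apply Complex.ext <;> simp

theorem fold_im_nonneg (a : ℝ) (z : ℂ) : 0 ≤ (fold a z).im := norm_nonneg _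

theorem le_fold_re (a : ℝ) (z : ℂ) : a ≤ (fold a z).re := by simp [fold]

theorem fold_fold (a : ℝ) (z : ℂ) : fold a (fold a z) = fold a z := by
  rw [fold_of_le_re (le_fold_re a z), abs_of_nonneg (fold_im_nonneg a z)]

theorem fold_conj (a : ℝ) (z : ℂ) : fold a (conj z) = fold a z := by
  rcases le_total a z.re with h | h
  · rw [fold_of_le_re h, fold_of_le_re (by simpa using h)]
    simp
  · rw [fold_of_re_le h, fold_of_re_le (by simpa using h), ← Complex.norm_conj (z - a)]
    simp

theorem lipschitzWith_fold (a : ℝ) : LipschitzWith 1 (fold a) := by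
  refine LipschitzWith.of_dist_le_mul fun z w => ?_
  rw [NNReal.coe_one, one_mul, dist_eq_norm, dist_eq_norm]
  have h1 : |(fold a z - fold a w).im| ≤
      ‖(⟨min (z.re - a) 0, z.im⟩ : ℂ) - ⟨min (w.re - a) 0, w.im⟩‖ := abs_norm_sub_norm_le _ _
  have h2 : (fold a z - fold a w).re = max (z.re - a) 0 - max (w.re - a) 0 := by
    simp [fold]
  have h3 := pow_le_pow_left₀ (abs_nonneg _) h1 2
  rw [sq_abs, sq, ← Complex.normSq_eq_norm_sq, Complex.normSq_apply] at h3
  refine (sq_le_sq₀ (norm_nonneg _) (norm_nonneg _)).1 ?_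
  rw [← Complex.normSq_eq_norm_sq, ← Complex.normSq_eq_norm_sq, Complex.normSq_apply,
    Complex.normSq_apply, h2]
  simp only [Complex.sub_re, Complex.sub_im] at h3 ⊢
  rcases max_cases (z.re - a) 0 with ⟨e1, _⟩ | ⟨e1, _⟩ <;>
  rcases max_cases (w.re - a) 0 with ⟨e2, _⟩ | ⟨e2, _⟩ <;>
  rcases min_cases (z.re - a) 0 with ⟨e3, _⟩ | ⟨e3, _⟩ <;>
  rcases min_cases (w.re - a) 0 with ⟨e4, _⟩ | ⟨e4, _⟩ <;>
  rw [e1, e2] <;> rw [e3, e4] at h3 <;> nlinarith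

theorem norm_fold_sub (a : ℝ) (z : ℂ) : ‖fold a z - a‖ = ‖z - a‖ := by
  rcases le_total a z.re with h | h
  · rw [fold_of_le_re h, Complex.norm_def, Complex.norm_def]
    simp [Complex.normSq_apply]
  · rw [fold_of_re_le h]
    rw [← Complex.abs_im_eq_norm.2 (by simp)]
    simp

theorem norm_sub_le_norm_sub_of_re (hz : z.re ≤ a) (he : e.im = 0) (hae : a ≤ e.re) :
    ‖z - a‖ ≤ ‖z - e‖ := by
  rw [Complex.norm_def, Complex.norm_def]
  refine Real.sqrt_le_sqrt ?_
  simp only [Complex.normSq_apply, Complex.sub_re, Complex.sub_im, Complex.ofReal_re,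
    Complex.ofReal_im, he]
  nlinarith

theorem norm_sub_eq_norm_fold_sub (hz : a ≤ z.re) (he : e.im = 0) : ‖z - e‖ = ‖fold a z - e‖ := by
  rw [fold_of_le_re hz, Complex.norm_def, Complex.norm_def]
  simp [Complex.normSq_apply, he]

theorem norm_sub_le_norm_fold_sub (he : e.im = 0) (hae : e.re ≤ a) :
    ‖z - a‖ ≤ ‖fold a z - e‖ := by
  rw [← norm_fold_sub]
  have := le_fold_re a z
  rw [Complex.norm_def, Complex.norm_def]
  refine Real.sqrt_le_sqrt ?_
  simp only [Complex.normSq_apply, Complex.sub_re, Complex.sub_im, Complex.ofReal_re,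
    Complex.ofReal_im, he]
  nlinarith

theorem norm_sub_le_norm_fold_sub_of_re_le (hz : z.re ≤ a) (he : e.im = 0) :
    ‖z - a‖ ≤ ‖fold a z - e‖ := by
  rw [fold_of_re_le hz]
  refine le_trans ?_ (Complex.abs_im_le_norm _)
  simp [he]

end Fold

section RightSlit

variable {a : ℝ} {U V : Set ℂ} {x y z w : ℂ}

/-- A domain whose complement lies on the ray `[a, ∞)` and contains `a`. -/
structure IsRightSlit (a : ℝ) (U : Set ℂ) : Prop where
  isOpen : IsOpen U
  notMem : (a : ℂ) ∉ U
  of_notMem : ∀ e ∉ U, e.im = 0 ∧ a ≤ e.re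
  joined : ∀ x ∈ U, ∀ y ∈ U, CurveJoined U x y

/-- An open subset of `U` obtained by removing points of the ray `(-∞, a]`. -/
structure IsLeftCut (a : ℝ) (U V : Set ℂ) : Prop where
  isOpen : IsOpen V
  subset : V ⊆ U
  of_notMem : ∀ e ∉ V, e ∉ U ∨ e.im = 0 ∧ e.re ≤ a

theorem qhDist_conj_le (hU : IsOpen U) (hne : Uᶜ.Nonempty) (him : ∀ e ∉ U, e.im = 0)
    (h : CurveJoined U x y) :
    CurveJoined U (conj x) (conj y) ∧ qhDist U (conj x) (conj y) ≤ qhDist U x y := by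
  refine qhDist_map_le hU hne hU hne (φ := fun z => conj z)
    (LipschitzWith.of_dist_le_mul fun z w => ?_) (fun z hz => ?_) h
  · simp [Complex.dist_conj_conj]
  · refine (le_infDist hne).2 fun e he => (infDist_le_dist_of_mem he).trans_eq ?_
    have : conj e = e := Complex.conj_eq_iff_im.2 (him e he)
    rw [← Complex.dist_conj_conj, this]

theorem qhDist_conj (hU : IsOpen U) (hne : Uᶜ.Nonempty) (him : ∀ e ∉ U, e.im = 0)
    (h : CurveJoined U x y) : qhDist U (conj x) (conj y) = qhDist U x y := by
  obtain ⟨h1, h2⟩ := qhDist_conj_le hU hne him h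
  have h3 := (qhDist_conj_le hU hne him h1).2
  simp only [Complex.conj_conj] at h3
  exact le_antisymm h2 h3

/-- A curve from the upper to the lower half plane crosses the real axis. -/
theorem exists_real_crossing (hU : IsOpen U) (hne : Uᶜ.Nonempty) (h : CurveJoined U x y)
    (hx : 0 ≤ x.im) (hy : y.im ≤ 0) {ε : ℝ} (hε : 0 < ε) :
    ∃ q ∈ U, q.im = 0 ∧ CurveJoined U x q ∧ qhDist U x q + qhDist U q y ≤ qhDist U x y + ε := by
  obtain ⟨γ, hγ, hl⟩ := h.exists_curveLen_lt hε
  have hc : ContinuousOn (fun t => (γ t).im) (Icc 0 1) :=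
    Complex.continuous_im.comp_continuousOn hγ.1.continuousOn
  obtain ⟨t, ht, h0⟩ := intermediate_value_Icc' zero_le_one hc
    (show (0:ℝ) ∈ _ by rw [hγ.2.1, hγ.2.2.1]; exact ⟨hy, hx⟩)
  refine ⟨γ t, hγ.2.2.2 t ht, h0, ?_, (qhDist_add_le_curveLen hU hne hγ ht).trans hl.le⟩
  simpa [hγ.2.1] using curveJoined_subarc hU hne hγ (a := 0) (by simp) ht

namespace IsRightSlit

theorem nonempty_compl (h : IsRightSlit a U) : Uᶜ.Nonempty := ⟨a, h.notMem⟩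

theorem infDist_eq (h : IsRightSlit a U) (hz : z.re ≤ a) : infDist z Uᶜ = ‖z - a‖ := by
  rw [← dist_eq_norm]
  refine le_antisymm (infDist_le_dist_of_mem h.notMem) ((le_infDist h.nonempty_compl).2 ?_)
  intro e he
  rw [dist_eq_norm, dist_eq_norm]
  exact norm_sub_le_norm_sub_of_re hz (h.of_notMem e he).1 (h.of_notMem e he).2

theorem infDist_le (h : IsRightSlit a U) (z : ℂ) : infDist z Uᶜ ≤ ‖z - a‖ := by
  rw [← dist_eq_norm]
  exact infDist_le_dist_of_mem h.notMem

theorem ne (h : IsRightSlit a U) (hz : z ∈ U) : z ≠ a := fun e => h.notMem (e ▸ hz)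

theorem mem_of_re_le (h : IsRightSlit a U) (hz : z.re ≤ a) (hza : z ≠ a) : z ∈ U := by
  refine mem_of_infDist_compl_pos ?_
  rw [h.infDist_eq hz]
  exact norm_pos_iff.2 (sub_ne_zero.2 hza)

theorem qhDist_exp_le (h : IsRightSlit a U) {c d : ℂ}
    (hc : c.im ∈ Icc (Real.pi / 2) (3 * Real.pi / 2))
    (hd : d.im ∈ Icc (Real.pi / 2) (3 * Real.pi / 2)) :
    qhDist U (a + exp c) (a + exp d) ≤ ‖d - c‖ := by
  let γ : ℝ → ℂ := fun t => a + exp (c + t * (d - c))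
  have hder : ∀ t : ℝ, HasDerivAt γ (exp (c + t * (d - c)) * (d - c)) t := fun t => by
    have h1 := ((Complex.ofRealCLM.hasDerivAt (x := t)).mul_const (d - c)).const_add c
    simp only [Complex.ofRealCLM_apply, Complex.ofReal_one, one_mul] at h1
    exact h1.cexp.const_add (a : ℂ)
  have hre : ∀ t ∈ Icc (0:ℝ) 1, (γ t).re ≤ a := fun t ht => by
    have him : (c + t * (d - c)).im ∈ Icc (Real.pi / 2) (3 * Real.pi / 2) := by
      have e : (c + t * (d - c)).im = (1 - t) * c.im + t * d.im := by
        simp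
        ring
      rw [e]
      exact (convex_Icc _ _) hc hd (sub_nonneg.2 ht.2) ht.1 (by ring)
    have hcos : Real.cos (c + t * (d - c)).im ≤ 0 :=
      Real.cos_nonpos_of_pi_div_two_le_of_le him.1 (by linarith [him.2])
    have e : (γ t).re = a + (exp (c + t * (d - c))).re := Complex.add_re _ _
    rw [e, Complex.exp_re]
    linarith [mul_nonpos_of_nonneg_of_nonpos (Real.exp_pos (c + t * (d - c)).re).le hcos]
  have hγ : γ ∈ curvesIn U (a + exp c) (a + exp d) := by
    refine ⟨ContDiff.contDiffOn ?_, by simp [γ], by simp [γ], fun t ht =>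
      h.mem_of_re_le (hre t ht) (by simp [γ, Complex.exp_ne_zero])⟩
    exact contDiff_const.add
      (contDiff_const.add (Complex.ofRealCLM.contDiff.mul contDiff_const)).cexp
  refine (qhDist_le_curveLen hγ).trans_eq ?_
  have : ∀ t ∈ uIcc (0:ℝ) 1, qhDensity U (γ t) * ‖deriv γ t‖ = ‖d - c‖ := fun t ht => by
    rw [uIcc_of_le zero_le_one] at ht
    rw [(hder t).deriv, qhDensity, h.infDist_eq (hre t ht), norm_mul]
    simp only [γ, add_sub_cancel_left]
    rw [inv_mul_cancel_left₀ (by simp [Complex.exp_ne_zero])]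
  rw [curveLen, intervalIntegral.integral_congr this]
  simp

theorem exists_eq_add_exp (hz : z.re ≤ a) (hza : z ≠ a) :
    ∃ c : ℂ, z = a + exp c ∧ c.re = Real.log ‖z - a‖ ∧
      c.im ∈ Icc (Real.pi / 2) (3 * Real.pi / 2) := by
  have h0 : (a : ℂ) - z ≠ 0 := sub_ne_zero.2 hza.symm
  refine ⟨log (a - z) + Real.pi * I, ?_, ?_, ?_⟩
  · rw [Complex.exp_add, Complex.exp_log h0, Complex.exp_pi_mul_I]
    ring
  · simp [Complex.log_re, norm_sub_rev]
  · have := abs_le.1 (Complex.abs_arg_le_pi_div_two_iff.2 (by simpa using hz :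
      0 ≤ ((a : ℂ) - z).re))
    simp only [Complex.add_im, Complex.log_im, Complex.mul_im, Complex.ofReal_re, Complex.I_im,
      Complex.ofReal_im, Complex.I_re]
    constructor <;> linarith [this.1, this.2]

/-- Circular arcs around `a` in the left half plane have length at most `π`. -/
theorem qhDist_le_pi (h : IsRightSlit a U) (hz : z.re ≤ a) (hw : w.re ≤ a) (hza : z ≠ a)
    (hzw : ‖z - a‖ = ‖w - a‖) : qhDist U z w ≤ Real.pi := by
  have hwa : w ≠ a := by
    rw [← sub_ne_zero, ← norm_pos_iff, ← hzw]
    exact norm_pos_iff.2 (sub_ne_zero.2 hza)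
  obtain ⟨c, hc, hcr, hci⟩ := exists_eq_add_exp hz hza
  obtain ⟨d, hd, hdr, hdi⟩ := exists_eq_add_exp hw hwa
  have h1 := h.qhDist_exp_le hci hdi
  rw [← hc, ← hd] at h1
  refine h1.trans ?_
  rw [← Complex.abs_im_eq_norm.2 (by simp [hcr, hdr, hzw]), Complex.sub_im]
  exact abs_le.2 ⟨by linarith [hci.2, hdi.1], by linarith [hci.1, hdi.2]⟩

theorem mk_mem (h : IsRightSlit a U) {r : ℝ} (hr : 0 < r) : (⟨a, r⟩ : ℂ) ∈ U :=
  h.mem_of_re_le le_rfl fun e => hr.ne' (by simpa using congrArg Complex.im e)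

/-- The ray from `a` going up is a quasihyperbolic geodesic. -/
theorem qhDist_mk_exp (h : IsRightSlit a U) (s t : ℝ) :
    qhDist U ⟨a, Real.exp s⟩ ⟨a, Real.exp t⟩ = |s - t| := by
  have hn : ∀ s : ℝ, ‖(⟨a, Real.exp s⟩ : ℂ) - a‖ = Real.exp s := fun s => by
    rw [← Complex.abs_im_eq_norm.2 (by simp)]
    simp
  have he : ∀ s : ℝ, (a : ℂ) + exp (s + (Real.pi / 2 : ℝ) * I) = ⟨a, Real.exp s⟩ := fun s => by
    rw [Complex.exp_add, Complex.ofReal_div, Complex.ofReal_ofNat, Complex.exp_pi_div_two_mul_I,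
      ← Complex.ofReal_exp]
    apply Complex.ext
    · simp only [Complex.add_re, Complex.ofReal_re, Complex.re_ofReal_mul, Complex.I_re, mul_zero,
        add_zero]
    · simp only [Complex.add_im, Complex.ofReal_im, Complex.im_ofReal_mul, Complex.I_im, mul_one,
        zero_add]
  refine le_antisymm ?_ ?_
  · have hpi := Real.pi_pos
    have hm : ∀ s : ℝ, (s + (Real.pi / 2 : ℝ) * I : ℂ).im ∈
        Icc (Real.pi / 2) (3 * Real.pi / 2) := fun s => by
      rw [show (s + (Real.pi / 2 : ℝ) * I : ℂ).im = Real.pi / 2 by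
        simp only [Complex.add_im, Complex.ofReal_im, Complex.im_ofReal_mul, Complex.I_im, mul_one,
          zero_add] ]
      constructor <;> linarith
    have h1 := h.qhDist_exp_le (hm s) (hm t)
    rwa [he, he, add_sub_add_right_eq_sub, ← Complex.ofReal_sub, Complex.norm_real,
      Real.norm_eq_abs, abs_sub_comm] at h1
  · have h1 := abs_log_sub_log_le_qhDist h.isOpen h.nonempty_compl (h := fun z => ‖z - a‖)
      (fun z w => by simpa using abs_norm_sub_norm_le (w - a) (z - a))
      (fun z _ => h.infDist_le z)
      (h.joined _ (h.mk_mem (Real.exp_pos s)) _ (h.mk_mem (Real.exp_pos t)))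
    simp only [hn, Real.log_exp] at h1
    rwa [abs_sub_comm] at h1

end IsRightSlit

end RightSlit

section Cut

variable {a : ℝ} {U V : Set ℂ} {x y z w p : ℂ}

namespace IsLeftCut

theorem nonempty_compl (hV : IsLeftCut a U V) (h : IsRightSlit a U) : Vᶜ.Nonempty :=
  ⟨a, fun ha => h.notMem (hV.subset ha)⟩

theorem im_eq_zero (hV : IsLeftCut a U V) (h : IsRightSlit a U) : ∀ e ∉ V, e.im = 0 := fun e he =>
  (hV.of_notMem e he).elim (fun h' => (h.of_notMem e h').1) fun h' => h'.1

theorem qhDist_le (hV : IsLeftCut a U V) (h : IsRightSlit a U) (hxy : CurveJoined V x y) :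
    qhDist U x y ≤ qhDist V x y :=
  (qhDist_map_le hV.isOpen (hV.nonempty_compl h) h.isOpen h.nonempty_compl (φ := id)
    LipschitzWith.id (fun _ _ => infDist_le_infDist_of_subset (compl_subset_compl.2 hV.subset)
      h.nonempty_compl) hxy).2

theorem fold_contraction (hV : IsLeftCut a U V) (h : IsRightSlit a U) (hx : x ∈ U) (hy : y ∈ U) :
    CurveJoined V (fold a x) (fold a y) ∧ qhDist V (fold a x) (fold a y) ≤ qhDist U x y := by
  refine qhDist_map_le h.isOpen h.nonempty_compl hV.isOpen (hV.nonempty_compl h)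
    (lipschitzWith_fold a) (fun z _ => (le_infDist (hV.nonempty_compl h)).2 fun e he => ?_)
    (h.joined x hx y hy)
  rw [dist_eq_norm]
  rcases hV.of_notMem e he with he | ⟨he, hea⟩
  · rcases le_total a z.re with hz | hz
    · rw [← norm_sub_eq_norm_fold_sub hz (h.of_notMem e he).1, ← dist_eq_norm]
      exact infDist_le_dist_of_mem he
    · exact (h.infDist_le z).trans
        (norm_sub_le_norm_fold_sub_of_re_le hz (h.of_notMem e he).1)
  · exact (h.infDist_le z).trans (norm_sub_le_norm_fold_sub he hea)

end IsLeftCut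

namespace IsRightSlit

theorem isLeftCut_self (h : IsRightSlit a U) : IsLeftCut a U U :=
  ⟨h.isOpen, Subset.rfl, fun _ he => Or.inl he⟩

theorem im_eq_zero (h : IsRightSlit a U) : ∀ e ∉ U, e.im = 0 := fun e he => (h.of_notMem e he).1

theorem isPseudoDistOn (h : IsRightSlit a U) : IsPseudoDistOn U (qhDist U) :=
  isPseudoDistOn_qhDist h.isOpen h.nonempty_compl h.joined

theorem qhDist_fold_le (h : IsRightSlit a U) (hx : x ∈ U) (hy : y ∈ U) :
    qhDist U (fold a x) (fold a y) ≤ qhDist U x y :=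
  (h.isLeftCut_self.fold_contraction h hx hy).2

theorem fold_mem (h : IsRightSlit a U) (hx : x ∈ U) : fold a x ∈ U :=
  (h.isLeftCut_self.fold_contraction h hx hx).1.left_mem

theorem conj_mem (h : IsRightSlit a U) (hx : x ∈ U) : conj x ∈ U :=
  (qhDist_conj_le h.isOpen h.nonempty_compl h.im_eq_zero (h.joined x hx x hx)).1.left_mem

theorem qhDist_conj (h : IsRightSlit a U) (hx : x ∈ U) (hy : y ∈ U) :
    qhDist U (conj x) (conj y) = qhDist U x y :=
  _root_.qhDist_conj h.isOpen h.nonempty_compl h.im_eq_zero (h.joined x hx y hy)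

theorem qhDist_fold_self_le (h : IsRightSlit a U) (hz : z ∈ U) (him : 0 ≤ z.im) :
    qhDist U z (fold a z) ≤ Real.pi := by
  rcases le_total a z.re with hre | hre
  · rw [fold_of_le_re hre, abs_of_nonneg him]
    exact (qhDist_self hz).trans_le Real.pi_pos.le
  · refine h.qhDist_le_pi hre ?_ (h.ne hz) (norm_fold_sub a z).symm
    rw [fold_of_re_le hre]

theorem qhDist_conj_fold_self_le (h : IsRightSlit a U) (hz : z ∈ U) (him : z.im ≤ 0) :
    qhDist U z (conj (fold a z)) ≤ Real.pi := by
  have := h.qhDist_fold_self_le (h.conj_mem hz) (by simpa using him)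
  rw [fold_conj, ← h.qhDist_conj (h.conj_mem hz) (h.fold_mem hz), Complex.conj_conj] at this
  exact this

/-- The images under `fold` of the real points of `U`. -/
def foldedAxis (a : ℝ) (U : Set ℂ) : Set ℂ := {p | ∃ q ∈ U, q.im = 0 ∧ p = fold a q}

theorem foldedAxis_subset (h : IsRightSlit a U) : foldedAxis a U ⊆ U := by
  rintro _ ⟨q, hq, -, rfl⟩
  exact h.fold_mem hq

theorem fold_of_mem_foldedAxis (hp : p ∈ foldedAxis a U) : fold a p = p := by
  obtain ⟨q, -, -, rfl⟩ := hp
  exact fold_fold a q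

theorem mk_mem_foldedAxis (h : IsRightSlit a U) {r : ℝ} (hr : 0 < r) :
    (⟨a, r⟩ : ℂ) ∈ foldedAxis a U := by
  refine ⟨((a - r : ℝ) : ℂ), h.mem_of_re_le (by simpa using hr.le) ?_, by simp, ?_⟩
  · rw [Ne, Complex.ofReal_inj]
    linarith
  · rw [fold_of_re_le (by simpa using hr.le), ← Complex.ofReal_sub, Complex.norm_real,
      sub_sub_cancel_left, norm_neg, Real.norm_of_nonneg hr.le]

theorem mem_foldedAxis_cases (h : IsRightSlit a U) (hp : p ∈ foldedAxis a U) :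
    p.im = 0 ∨ ∃ s : ℝ, p = ⟨a, Real.exp s⟩ := by
  obtain ⟨q, hq, h0, rfl⟩ := hp
  rcases le_total a q.re with hre | hre
  · left
    rw [fold_of_le_re hre]
    simp [h0]
  · right
    refine ⟨Real.log ‖q - a‖, ?_⟩
    rw [fold_of_re_le hre, Real.exp_log (norm_pos_iff.2 (sub_ne_zero.2 (h.ne hq)))]

theorem qhDist_conj_self_le (h : IsRightSlit a U) (hp : p ∈ foldedAxis a U) :
    qhDist U p (conj p) ≤ Real.pi := by
  have hpU := h.foldedAxis_subset hp
  rcases h.mem_foldedAxis_cases hp with h0 | ⟨s, rfl⟩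
  · rw [Complex.conj_eq_iff_im.2 h0]
    exact (qhDist_self hpU).trans_le Real.pi_pos.le
  · refine h.qhDist_le_pi le_rfl (by simp) (h.ne hpU) ?_
    rw [← Complex.norm_conj (_ - _)]
    simp

theorem abs_qhDist_sub_fold_le (h : IsRightSlit a U) (hz : z ∈ U) (hw : w ∈ U)
    (hs : 0 ≤ z.im ↔ 0 ≤ w.im) :
    |qhDist U z w - qhDist U (fold a z) (fold a w)| ≤ 2 * Real.pi := by
  have hd := h.isPseudoDistOn
  have key : ∀ z' ∈ U, ∀ w' ∈ U, qhDist U z z' ≤ Real.pi → qhDist U w w' ≤ Real.pi →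
      |qhDist U z w - qhDist U z' w'| ≤ 2 * Real.pi := by
    intro z' hz' w' hw' h1 h2
    have e1 := hd.triangle z hz z' hz' w hw
    have e2 := hd.triangle z' hz' w' hw' w hw
    have e3 := hd.triangle z' hz' z hz w' hw'
    have e4 := hd.triangle z hz w hw w' hw'
    rw [hd.symm z' hz' z hz] at e3
    rw [hd.symm w' hw' w hw] at e2
    exact abs_le.2 ⟨by linarith, by linarith⟩
  by_cases h0 : 0 ≤ z.im
  · exact key _ (h.fold_mem hz) _ (h.fold_mem hw) (h.qhDist_fold_self_le hz h0)
      (h.qhDist_fold_self_le hw (hs.1 h0))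
  · have h0' : ¬ 0 ≤ w.im := fun h' => h0 (hs.2 h')
    rw [← h.qhDist_conj (h.fold_mem hz) (h.fold_mem hw)]
    exact key _ (h.conj_mem (h.fold_mem hz)) _ (h.conj_mem (h.fold_mem hw))
      (h.qhDist_conj_fold_self_le hz (not_le.1 h0).le)
      (h.qhDist_conj_fold_self_le hw (not_le.1 h0').le)

theorem qhDist_le_add_of_opposite (h : IsRightSlit a U) (hz : z ∈ U) (hw : w ∈ U)
    (hzi : 0 ≤ z.im) (hwi : w.im ≤ 0) (hp : p ∈ foldedAxis a U) :
    qhDist U z w ≤ qhDist U (fold a z) p + qhDist U p (fold a w) + 3 * Real.pi := by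
  have hd := h.isPseudoDistOn
  have hpU := h.foldedAxis_subset hp
  have hzf := h.fold_mem hz
  have hwf := h.fold_mem hw
  have hwc := h.conj_mem hwf
  have hpc := h.conj_mem hpU
  have e1 := hd.triangle z hz _ hzf w hw
  have e2 := hd.triangle _ hzf p hpU w hw
  have e3 := hd.triangle p hpU _ hpc w hw
  have e4 := hd.triangle _ hpc _ hwc w hw
  rw [h.qhDist_conj hpU hwf, hd.symm _ hwc w hw] at e4
  linarith [h.qhDist_fold_self_le hz hzi, h.qhDist_conj_fold_self_le hw hwi,
    h.qhDist_conj_self_le hp]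

theorem exists_foldedAxis_le_of_opposite (h : IsRightSlit a U) (hz : z ∈ U) (hw : w ∈ U)
    (hzi : 0 ≤ z.im) (hwi : w.im ≤ 0) :
    ∃ p ∈ foldedAxis a U,
      qhDist U (fold a z) p + qhDist U p (fold a w) ≤ qhDist U z w + 1 := by
  obtain ⟨q, hq, h0, -, hl⟩ := exists_real_crossing h.isOpen h.nonempty_compl
    (h.joined z hz w hw) hzi hwi one_pos
  exact ⟨fold a q, ⟨q, hq, h0, rfl⟩,
    (add_le_add (h.qhDist_fold_le hz hq) (h.qhDist_fold_le hq hw)).trans hl⟩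

/-- The points of `U` fixed by the folding map. -/
def foldedPart (a : ℝ) (U : Set ℂ) : Set ℂ := {z | z ∈ U ∧ fold a z = z}

theorem foldedAxis_subset_foldedPart (h : IsRightSlit a U) : foldedAxis a U ⊆ foldedPart a U :=
  fun _ hp => ⟨h.foldedAxis_subset hp, fold_of_mem_foldedAxis hp⟩

end IsRightSlit

open IsRightSlit

namespace IsLeftCut

theorem joined_of_mem_foldedPart (hV : IsLeftCut a U V) (h : IsRightSlit a U)
    (hx : x ∈ foldedPart a U) (hy : y ∈ foldedPart a U) : CurveJoined V x y := by
  have := (hV.fold_contraction h hx.1 hy.1).1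
  rwa [hx.2, hy.2] at this

theorem qhDist_eq_of_mem_foldedPart (hV : IsLeftCut a U V) (h : IsRightSlit a U)
    (hx : x ∈ foldedPart a U) (hy : y ∈ foldedPart a U) : qhDist V x y = qhDist U x y := by
  obtain ⟨h1, h2⟩ := hV.fold_contraction h hx.1 hy.1
  rw [hx.2, hy.2] at h1 h2
  exact le_antisymm h2 (hV.qhDist_le h h1)

theorem exists_foldedAxis_point_of_im_eq_zero (hV : IsLeftCut a U V) (h : IsRightSlit a U) {δ : ℝ}
    (h4 : FourPointOn {z | CurveJoined V x z} (qhDist V) δ) (hx : x ∈ foldedPart a U)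
    {b c : ℂ} (hb : b ∈ foldedPart a U) (hc : c ∈ foldedPart a U) (hb0 : b.im = 0)
    (hc0 : c.im = 0) (hw : w ∈ foldedPart a U) :
    ∃ p ∈ foldedAxis a U, 2 * qhDist U w p ≤
      qhDist U w b + qhDist U w c - qhDist U b c + (δ + 1) := by
  have hVo := hV.isOpen
  have hVn := hV.nonempty_compl h
  have hVi := hV.im_eq_zero h
  have Jb := hV.joined_of_mem_foldedPart h hx hb
  have Jbw := hV.joined_of_mem_foldedPart h hb hw
  have Jcw := hV.joined_of_mem_foldedPart h hc hw
  have eb : conj b = b := Complex.conj_eq_iff_im.2 hb0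
  have ec : conj c = c := Complex.conj_eq_iff_im.2 hc0
  have Jbw' := (qhDist_conj_le hVo hVn hVi Jbw).1
  have hbw' := _root_.qhDist_conj hVo hVn hVi Jbw
  have hcw' := _root_.qhDist_conj hVo hVn hVi Jcw
  rw [eb] at Jbw' hbw'
  rw [ec] at hcw'
  have e := h4 b Jb c (hV.joined_of_mem_foldedPart h hx hc) w
    (hV.joined_of_mem_foldedPart h hx hw) (conj w) (Jb.trans hVo hVn Jbw')
  rw [hbw', hcw', max_self, hV.qhDist_eq_of_mem_foldedPart h hb hc,
    hV.qhDist_eq_of_mem_foldedPart h hb hw, hV.qhDist_eq_of_mem_foldedPart h hc hw] at e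
  have hwi : 0 ≤ w.im := by
    rw [← hw.2]
    exact fold_im_nonneg a w
  obtain ⟨q, hq, h0, Jq, hl⟩ := exists_real_crossing hVo hVn
    (Jbw.symm.trans hVo hVn Jbw') hwi (by simpa using hwi) one_pos
  have hq' := _root_.qhDist_conj hVo hVn hVi Jq
  rw [Complex.conj_eq_iff_im.2 h0, qhDist_comm] at hq'
  have hqU := hV.subset hq
  have hf := h.qhDist_fold_le hw.1 hqU
  rw [hw.2] at hf
  have hs := hV.qhDist_le h Jq
  refine ⟨fold a q, ⟨q, hqU, h0, rfl⟩, ?_⟩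
  rw [qhDist_comm U w b, qhDist_comm U w c]
  linarith

end IsLeftCut

namespace IsRightSlit

theorem exists_foldedAxis_point_of_mk (h : IsRightSlit a U) {δ : ℝ}
    (h4 : FourPointOn (foldedPart a U) (qhDist U) δ) (s t : ℝ) (hw : w ∈ foldedPart a U) :
    ∃ p ∈ foldedAxis a U, 2 * qhDist U w p ≤ qhDist U w ⟨a, Real.exp s⟩ +
      qhDist U w ⟨a, Real.exp t⟩ - qhDist U ⟨a, Real.exp s⟩ ⟨a, Real.exp t⟩ + 2 * δ := by
  have hA := h.foldedAxis_subset_foldedPart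
  have hm : ∀ s : ℝ, (⟨a, Real.exp s⟩ : ℂ) ∈ foldedAxis a U := fun s =>
    h.mk_mem_foldedAxis (Real.exp_pos s)
  have key : ∀ s t : ℝ, s ≤ t → ∃ p ∈ foldedAxis a U, 2 * qhDist U w p ≤
      qhDist U w ⟨a, Real.exp s⟩ + qhDist U w ⟨a, Real.exp t⟩ -
        qhDist U ⟨a, Real.exp s⟩ ⟨a, Real.exp t⟩ + 2 * δ := by
    intro s t hst
    have hst' : |s - t| = t - s := by rw [abs_sub_comm, abs_of_nonneg (sub_nonneg.2 hst)]
    obtain ⟨r, -, hr⟩ := exists_geodesic_point_le h4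
      (h.isPseudoDistOn.mono fun z hz => hz.1) (hA (hm s)) (hA (hm t)) hw
      (p := fun r => ⟨a, Real.exp (s + r)⟩) (fun r hr => by
        rw [h.qhDist_mk_exp, hst'] at hr
        refine ⟨hA (hm _), ?_, ?_⟩
        · rw [h.qhDist_mk_exp, abs_sub_comm, add_sub_cancel_left, abs_of_nonneg hr.1]
        · rw [h.qhDist_mk_exp, h.qhDist_mk_exp, hst', abs_sub_comm, abs_of_nonneg]
          · ring
          · linarith [hr.2])
    exact ⟨_, hm _, hr⟩
  rcases le_total s t with hst | hst
  · exact key s t hst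
  · obtain ⟨p, hp, hl⟩ := key t s hst
    refine ⟨p, hp, ?_⟩
    rw [qhDist_comm U ⟨a, Real.exp s⟩]
    linarith

end IsRightSlit

/-- The folded axis is quasiconvex. -/
theorem IsLeftCut.exists_quasiconvex (hV : IsLeftCut a U V) (h : IsRightSlit a U) {δ : ℝ}
    (hδ : 0 ≤ δ) (hx : x ∈ foldedPart a U)
    (h4 : FourPointOn {z | CurveJoined V x z} (qhDist V) δ)
    (h4' : FourPointOn (foldedPart a U) (qhDist U) δ) :
    ∃ C, 0 ≤ C ∧ ∀ b ∈ foldedAxis a U, ∀ c ∈ foldedAxis a U, ∀ w ∈ foldedPart a U,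
      ∃ p ∈ foldedAxis a U, 2 * qhDist U w p ≤ qhDist U w b + qhDist U w c - qhDist U b c + C := by
  have hA := h.foldedAxis_subset_foldedPart
  have hd : IsPseudoDistOn (foldedPart a U) (qhDist U) := h.isPseudoDistOn.mono fun z hz => hz.1
  have hm : ∀ s : ℝ, (⟨a, Real.exp s⟩ : ℂ) ∈ foldedAxis a U := fun s =>
    h.mk_mem_foldedAxis (Real.exp_pos s)
  obtain ⟨T, hT0, hT⟩ : ∃ T, 0 ≤ T ∧ ∀ b ∈ foldedAxis a U, b.im = 0 →
      ∃ g ∈ foldedAxis a U, g.im = 0 ∧ qhDist U g ⟨a, Real.exp 0⟩ ≤ T := by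
    by_cases hg : ∃ g ∈ foldedAxis a U, g.im = 0
    · obtain ⟨g, hg, hg0⟩ := hg
      exact ⟨qhDist U g ⟨a, Real.exp 0⟩, qhDist_nonneg _ _ _, fun _ _ _ => ⟨g, hg, hg0, le_rfl⟩⟩
    · exact ⟨0, le_rfl, fun b hb hb0 => absurd ⟨b, hb, hb0⟩ hg⟩
  have mixed : ∀ b ∈ foldedAxis a U, b.im = 0 → ∀ s : ℝ, ∀ w ∈ foldedPart a U,
      ∃ p ∈ foldedAxis a U, 2 * qhDist U w p ≤ qhDist U w b + qhDist U w ⟨a, Real.exp s⟩ -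
        qhDist U b ⟨a, Real.exp s⟩ + (3 * δ + 2 * T + 1) := by
    intro b hb hb0 s w hw
    obtain ⟨g, hg, hg0, hgT⟩ := hT b hb hb0
    have e := h4' b (hA hb) _ (hA (hm s)) g (hA hg) w hw
    rw [qhDist_comm U g w, qhDist_comm U b w, qhDist_comm U ⟨a, Real.exp s⟩ w,
      qhDist_comm U ⟨a, Real.exp s⟩ g] at e
    rcases le_total (qhDist U b g + qhDist U w ⟨a, Real.exp s⟩)
      (qhDist U w b + qhDist U g ⟨a, Real.exp s⟩) with hle | hle
    · rw [max_eq_right hle] at e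
      obtain ⟨p, hp, hl⟩ := h.exists_foldedAxis_point_of_mk h4' 0 s hw
      refine ⟨p, hp, ?_⟩
      have e1 := hd.triangle w hw g (hA hg) _ (hA (hm 0))
      have e2 := hd.triangle g (hA hg) _ (hA (hm 0)) _ (hA (hm s))
      linarith
    · rw [max_eq_left hle] at e
      obtain ⟨p, hp, hl⟩ := hV.exists_foldedAxis_point_of_im_eq_zero h h4 hx (hA hb) (hA hg) hb0
        hg0 hw
      exact ⟨p, hp, by linarith⟩
  refine ⟨3 * δ + 2 * T + 1, by positivity, fun b hb c hc w hw => ?_⟩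
  rcases h.mem_foldedAxis_cases hb with hb0 | ⟨s, rfl⟩ <;>
    rcases h.mem_foldedAxis_cases hc with hc0 | ⟨t, rfl⟩
  · obtain ⟨p, hp, hl⟩ := hV.exists_foldedAxis_point_of_im_eq_zero h h4 hx (hA hb) (hA hc) hb0
      hc0 hw
    exact ⟨p, hp, by linarith⟩
  · exact mixed b hb hb0 t w hw
  · obtain ⟨p, hp, hl⟩ := mixed c hc hc0 s w hw
    refine ⟨p, hp, ?_⟩
    rw [qhDist_comm U ⟨a, Real.exp s⟩ c]
    linarith
  · obtain ⟨p, hp, hl⟩ := h.exists_foldedAxis_point_of_mk h4' s t hw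
    exact ⟨p, hp, by linarith⟩

/-- If a domain slit along `[a, ∞)` stays Gromov hyperbolic after cutting along `(-∞, a]`, it was
Gromov hyperbolic before. -/
theorem IsLeftCut.isGromovHyperbolic (hV : IsLeftCut a U V) (h : IsRightSlit a U)
    (hyp : IsGromovHyperbolic V (qhDist V)) : IsGromovHyperbolic U (qhDist U) := by
  have hA := h.foldedAxis_subset_foldedPart
  have hx : (⟨a, 1⟩ : ℂ) ∈ foldedAxis a U := h.mk_mem_foldedAxis one_pos
  obtain ⟨δ, hδ, h4⟩ := exists_fourPointOn_of_isGromovHyperbolic hV.isOpen (hV.nonempty_compl h)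
    hyp ⟨a, 1⟩
  have h4' : FourPointOn (foldedPart a U) (qhDist U) δ := by
    intro x' hx' y' hy' z' hz' w' hw'
    have hJ : ∀ v ∈ foldedPart a U, CurveJoined V ⟨a, 1⟩ v := fun v hv =>
      hV.joined_of_mem_foldedPart h (hA hx) hv
    have e := h4 x' (hJ x' hx') y' (hJ y' hy') z' (hJ z' hz') w' (hJ w' hw')
    simpa only [hV.qhDist_eq_of_mem_foldedPart h, hx', hy', hz', hw'] using e
  obtain ⟨C, hC, hQC⟩ := hV.exists_quasiconvex h hδ (hA hx) h4 h4'
  have hpi := Real.pi_gt_three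
  obtain ⟨δ', hδ'⟩ : ∃ δ, FourPointOn U (qhDist U) δ := by
    refine exists_fourPointOn_of_double (C := δ + C + 3 * Real.pi) (by positivity)
      (X := foldedPart a U) (fun z hz => hz.1) hA ⟨_, hx⟩ h.isPseudoDistOn
      (h4'.mono (by linarith)) (fun b hb c hc w hw => ?_) (fold a)
      (fun z hz => ⟨h.fold_mem hz, fold_fold a z⟩) (fun z => 0 ≤ z.im)
      (fun z hz w hw hs => (h.abs_qhDist_sub_fold_le hz hw hs).trans (by linarith))
      (fun z hz w hw hs => ?_)
    · obtain ⟨p, hp, hl⟩ := hQC b hb c hc w hw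
      exact ⟨p, hp, by linarith⟩
    · rcases le_or_gt 0 z.im with hzi | hzi
      · have hwi : w.im ≤ 0 := (not_le.1 fun hw' => hs ⟨fun _ => hw', fun _ => hzi⟩).le
        refine ⟨fun p hp => ?_, ?_⟩
        · linarith [h.qhDist_le_add_of_opposite hz hw hzi hwi hp]
        · obtain ⟨p, hp, hl⟩ := h.exists_foldedAxis_le_of_opposite hz hw hzi hwi
          exact ⟨p, hp, by linarith⟩
      · have hwi : 0 ≤ w.im := by
          by_contra hw'
          exact hs ⟨fun h' => absurd h' hzi.not_ge, fun h' => absurd h' hw'⟩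
        refine ⟨fun p hp => ?_, ?_⟩
        · rw [qhDist_comm U z w, qhDist_comm U (fold a z) p, qhDist_comm U p (fold a w)]
          linarith [h.qhDist_le_add_of_opposite hw hz hwi hzi.le hp]
        · obtain ⟨p, hp, hl⟩ := h.exists_foldedAxis_le_of_opposite hw hz hwi hzi.le
          refine ⟨p, hp, ?_⟩
          rw [qhDist_comm U z w, qhDist_comm U (fold a z) p, qhDist_comm U p (fold a w)]
          linarith
  exact ⟨3 / 2 * max δ' 0, by positivity,
    isGromovHyperbolicWith_of_fourPointOn (hδ'.mono (le_max_left _ _)) h.isPseudoDistOn⟩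

end Cut

section Denjoy

variable {Ω : Set ℂ}

theorem qhDist_univ (x y : ℂ) : qhDist univ x y = 0 := by
  have h : ∀ γ : ℝ → ℂ, curveLen (qhDensity univ) γ = 0 := fun γ => by
    simp [curveLen, qhDensity]
  rw [qhDist_eq_sInf]
  rcases (curvesIn univ x y).eq_empty_or_nonempty with he | ⟨γ, hγ⟩
  · simp [he]
  · rw [show curveLen (qhDensity univ) '' curvesIn univ x y = {0} from
      eq_singleton_iff_unique_mem.2 ⟨⟨γ, hγ, h γ⟩, by rintro _ ⟨γ', -, rfl⟩; exact h γ'⟩]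
    exact csInf_singleton 0

theorem isGromovHyperbolic_univ : IsGromovHyperbolic (univ : Set ℂ) (qhDist univ) :=
  ⟨0, le_rfl, fun x _ _ _ z _ _ gxz _ _ _ _ _ _ =>
    ⟨gxz 0, Or.inl ⟨0, ⟨le_rfl, (qhDist_univ x z).ge⟩, rfl⟩, (qhDist_univ _ _).le⟩⟩

/-- A preconnected set which meets an open set but not its frontier is contained in it. -/
theorem IsPreconnected.subset_of_inter_frontier_eq_empty {α : Type*} [TopologicalSpace α]
    {T W : Set α} (hT : IsPreconnected T) (hW : IsOpen W) (h : (T ∩ W).Nonempty)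
    (hd : T ∩ frontier W = ∅) : T ⊆ W := by
  refine hT.subset_left_of_subset_union hW isClosed_closure.isOpen_compl
    (disjoint_compl_right.mono_left subset_closure) (fun x hx => ?_) h
  by_contra hn
  rw [mem_union, mem_compl_iff, not_or, not_not] at hn
  have : x ∈ T ∩ frontier W := ⟨hx, by rw [hW.frontier_eq]; exact ⟨hn.2, hn.1⟩⟩
  rwa [hd] at this

/-- A Denjoy domain containing the negative axis contains everything off the real axis. -/
theorem IsDenjoyDomain.mem_of_im_ne_zero (hΩ : IsDenjoyDomain Ω)
    (hneg : {z : ℂ | z.im = 0 ∧ z.re < 0} ⊆ Ω) {z : ℂ} (hz : z.im ≠ 0) : z ∈ Ω := by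
  have hm : ((-1 : ℝ) : ℂ) ∈ Ω := hneg ⟨by simp, by simp⟩
  obtain ⟨ε, hε, hball⟩ := Metric.isOpen_iff.1 hΩ.1 _ hm
  have hpt : ∀ r : ℝ, |r| < ε → (⟨-1, r⟩ : ℂ) ∈ Ω := fun r hr => hball <| by
    rw [mem_ball, dist_eq_norm, ← Complex.abs_im_eq_norm.2 (by simp)]
    simpa using hr
  have hhalf : |ε / 2| < ε := by
    rw [abs_of_pos (half_pos hε)]
    exact half_lt_self hε
  have hfr : ∀ w ∈ frontier Ω, w.im = 0 := fun w hw => hΩ.2.2 hw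
  rcases hz.lt_or_gt with hz | hz
  · refine (convex_halfSpace_im_lt 0).isPreconnected.subset_of_inter_frontier_eq_empty hΩ.1
      ⟨⟨-1, -(ε / 2)⟩, by simpa using hε, hpt _ (by rwa [abs_neg])⟩ ?_ hz
    exact eq_empty_of_forall_notMem fun w hw => (show w.im < 0 from hw.1).ne (hfr w hw.2)
  · refine (convex_halfSpace_im_gt 0).isPreconnected.subset_of_inter_frontier_eq_empty hΩ.1
      ⟨⟨-1, ε / 2⟩, by simpa using hε, hpt _ hhalf⟩ ?_ hz
    exact eq_empty_of_forall_notMem fun w hw => (show 0 < w.im from hw.1).ne' (hfr w hw.2)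

theorem IsDenjoyDomain.exists_isRightSlit (hΩ : IsDenjoyDomain Ω)
    (hneg : {z : ℂ | z.im = 0 ∧ z.re < 0} ⊆ Ω) (hne : Ωᶜ.Nonempty) :
    ∃ a : ℝ, 0 ≤ a ∧ IsRightSlit a Ω := by
  have him : ∀ e ∉ Ω, e.im = 0 := fun e he => by
    by_contra h
    exact he (hΩ.mem_of_im_ne_zero hneg h)
  have hre : ∀ e ∉ Ω, 0 ≤ e.re := fun e he => by
    by_contra h
    exact he (hneg ⟨him e he, not_le.1 h⟩)
  have hreal : ∀ e ∉ Ω, ((e.re : ℝ) : ℂ) = e := fun e he =>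
    Complex.ext (by simp) (by simp [him e he])
  let E : Set ℝ := {t | ((t : ℝ) : ℂ) ∉ Ω}
  have hE : IsClosed E := hΩ.1.isClosed_compl.preimage Complex.continuous_ofReal
  have hEne : E.Nonempty := by
    obtain ⟨e, he⟩ := hne
    refine ⟨e.re, ?_⟩
    change ((e.re : ℝ) : ℂ) ∉ Ω
    rwa [hreal e he]
  have hEb : BddBelow E := ⟨0, fun t ht => by simpa using hre _ ht⟩
  have ha : sInf E ∈ E := hE.csInf_mem hEne hEb
  refine ⟨sInf E, by simpa using hre _ ha, hΩ.1, ha, fun e he => ⟨him e he, csInf_le hEb ?_⟩, ?_⟩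
  · change ((e.re : ℝ) : ℂ) ∉ Ω
    rwa [hreal e he]
  · exact fun x hx y hy =>
      curveJoined_of_isPreconnected hΩ.1 hne hΩ.2.1.isPreconnected Subset.rfl hx hy

end Denjoy

/-- Theorem 1.2, quasihyperbolic case: removing a closed subset of `(-∞, 0]` from a Denjoy
domain containing `(-∞, 0)` preserves non-Gromov-hyperbolicity of the quasihyperbolic metric. -/
theorem denjoy_qh_not_hyperbolic_remove_far_side
    (Ω F : Set ℂ)
    (hΩ : IsDenjoyDomain Ω)
    (hneg : {z : ℂ | z.im = 0 ∧ z.re < 0} ⊆ Ω)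
    (hFcl : IsClosed F)
    (hFsub : F ⊆ {z : ℂ | z.im = 0 ∧ z.re ≤ 0})
    (hnot : ¬ IsGromovHyperbolic Ω (qhDist Ω)) :
    ¬ IsGromovHyperbolic (Ω \ F) (qhDist (Ω \ F)) := by
  intro hyp
  rcases Ωᶜ.eq_empty_or_nonempty with he | hne
  · rw [compl_empty_iff.1 he] at hnot
    exact hnot isGromovHyperbolic_univ
  · obtain ⟨a, ha, h⟩ := hΩ.exists_isRightSlit hneg hne
    have hV : IsLeftCut a Ω (Ω \ F) := by
      refine ⟨hΩ.1.sdiff hFcl, sdiff_subset, fun e he => ?_⟩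
      by_cases heΩ : e ∈ Ω
      · have heF : e ∈ F := by
          by_contra h'
          exact he ⟨heΩ, h'⟩
        exact Or.inr ⟨(hFsub heF).1, (hFsub heF).2.trans ha⟩
      · exact Or.inl heΩ
    exact hnot (hV.isGromovHyperbolic h hyp)

end
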